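/- arXiv:2201.08777 — 2 statements merged into one kernel-verified Lean document; each statement's English description precedes it below -/
import Mathlib

section
/- Let $p$ be a prime, $N, n \geq 0$, and let $l \geq 1$. Let $f_1(t), \dots, f_l(t) \in \mathbb{Z}_p[t]$ be monic polynomials and let $G_1, \dots, G_l$ be finite abelian $p$-groups with $p^N G_j = 0$ for all $j$. Then the Haar probability that a random $X \in \mathrm{Mat}_n(\mathbb{Z}_p)$ satisfies $\mathrm{cok}(f_j(X)) \simeq G_j$ for all $1 \leq j \leq l$ equals the uniform probability that a random $X \in \mathrm{Mat}_n(\mathbb{Z}/p^{N+1}\mathbb{Z})$ satisfies $\mathrm{cok}(f_j(X)) \simeq G_j$ for all $1 \leq j \leq l$. -/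
open MeasureTheory
open scoped ENNReal

noncomputable instance (p : ℕ) [Fact p.Prime] : MeasurableSpace ℤ_[p] := borel _

theorem aux_cok (p : ℕ) [Fact p.Prime] (N n : ℕ) (A : Matrix (Fin n) (Fin n) ℤ_[p])
    (G : Type) [AddCommGroup G] (hG : ∀ x : G, (p ^ N : ℕ) • x = 0) :
    Nonempty (((Fin n → ℤ_[p]) ⧸ LinearMap.range A.mulVecLin) ≃+ G) ↔
    Nonempty (((Fin n → ZMod (p ^ (N + 1))) ⧸ LinearMap.range
      (A.map (PadicInt.toZModPow (p := p) (N + 1))).mulVecLin) ≃+ G) := by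
  set φ := PadicInt.toZModPow (p := p) (N + 1) with hφ
  have hsurj : Function.Surjective φ := ZMod.ringHom_surjective φ
  set L := LinearMap.range A.mulVecLin with hL
  set L' := LinearMap.range (A.map φ).mulVecLin with hL'
  -- the reduction map
  let r : (Fin n → ℤ_[p]) →+ (Fin n → ZMod (p ^ (N + 1))) :=
    { toFun := fun v => φ ∘ v
      map_zero' := by ext i; simp
      map_add' := fun v w => by ext i; simp }
  have hr : ∀ v, r v = φ ∘ v := fun _ => rfl
  have hrs : Function.Surjective r := fun w => by
    choose g hg using fun i => hsurj (w i)
    exact ⟨g, funext hg⟩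
  have hker : ∀ v, r v = 0 → ∃ w : Fin n → ℤ_[p], v = (p : ℤ_[p]) ^ (N + 1) • w := by
    intro v hv
    have : ∀ i, ∃ c, v i = (p : ℤ_[p]) ^ (N + 1) * c := by
      intro i
      have h1 : φ (v i) = 0 := congrFun hv i
      rw [← RingHom.mem_ker, hφ, PadicInt.ker_toZModPow, Ideal.mem_span_singleton] at h1
      exact h1
    choose w hw using this
    exact ⟨w, funext hw⟩
  have hrL : ∀ v ∈ L, r v ∈ L' := by
    rintro _ ⟨w, rfl⟩
    refine ⟨φ ∘ w, ?_⟩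
    ext i
    simp only [hr, Matrix.mulVecLin_apply, Function.comp]
    exact (RingHom.map_mulVec φ A w i).symm
  have hrL' : ∀ v, r v ∈ L' → ∃ u ∈ L, ∃ w, v = u + (p : ℤ_[p]) ^ (N + 1) • w := by
    rintro v ⟨w', hw'⟩
    obtain ⟨w, rfl⟩ := hrs w'
    have h0 : r (v - A.mulVecLin w) = 0 := by
      rw [map_sub, ← hw', sub_eq_zero]
      ext i
      simp only [hr, Matrix.mulVecLin_apply, Function.comp]
      exact (RingHom.map_mulVec φ A w i).symm
    obtain ⟨z, hz⟩ := hker _ h0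
    exact ⟨_, ⟨w, rfl⟩, z, by rw [← hz]; abel⟩
  have key : (∀ v : Fin n → ℤ_[p], (p : ℤ_[p]) ^ N • v ∈ L) →
      Nonempty (((Fin n → ℤ_[p]) ⧸ L) ≃+ ((Fin n → ZMod (p ^ (N + 1))) ⧸ L')) := by
    intro h
    let q : ((Fin n → ℤ_[p]) ⧸ L) →+ ((Fin n → ZMod (p ^ (N + 1))) ⧸ L') :=
      QuotientAddGroup.map L.toAddSubgroup L'.toAddSubgroup r hrL
    have hq : ∀ v, q (Submodule.Quotient.mk v) = Submodule.Quotient.mk (r v) := fun _ => rfl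
    refine ⟨AddEquiv.ofBijective q ⟨?_, ?_⟩⟩
    · rw [injective_iff_map_eq_zero]
      intro a ha
      obtain ⟨v, rfl⟩ := Submodule.Quotient.mk_surjective _ a
      rw [hq, Submodule.Quotient.mk_eq_zero] at ha
      obtain ⟨u, hu, w, rfl⟩ := hrL' v ha
      rw [Submodule.Quotient.mk_eq_zero]
      refine L.add_mem hu ?_
      rw [pow_succ, mul_smul]
      exact h _
    · intro b
      obtain ⟨w, rfl⟩ := Submodule.Quotient.mk_surjective _ b
      obtain ⟨v, rfl⟩ := hrs w
      exact ⟨Submodule.Quotient.mk v, hq v⟩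
  have hsm : ∀ v : Fin n → ℤ_[p], (p : ℤ_[p]) ^ N • v = (p ^ N : ℕ) • v := by
    intro v; ext i; simp
  constructor
  · rintro ⟨e⟩
    obtain ⟨k⟩ := key (by
      intro v
      rw [← Submodule.Quotient.mk_eq_zero, hsm, ← Submodule.mkQ_apply, map_nsmul]
      apply e.injective
      rw [map_nsmul, hG, map_zero])
    exact ⟨k.symm.trans e⟩
  · rintro ⟨e⟩
    have h1 : ∀ v : Fin n → ℤ_[p], r ((p : ℤ_[p]) ^ N • v) ∈ L' := by
      intro v
      rw [← Submodule.Quotient.mk_eq_zero, hsm, map_nsmul, ← Submodule.mkQ_apply, map_nsmul]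
      apply e.injective
      rw [map_nsmul, hG, map_zero]
    let M : Submodule ℤ_[p] (Fin n → ℤ_[p]) :=
      LinearMap.range (LinearMap.lsmul ℤ_[p] (Fin n → ℤ_[p]) ((p : ℤ_[p]) ^ N))
    have hM : M ≤ L := by
      apply Submodule.le_of_le_smul_of_le_jacobson_bot
        (I := IsLocalRing.maximalIdeal ℤ_[p]) (IsNoetherian.noetherian M)
      · rw [IsLocalRing.jacobson_eq_maximalIdeal ⊥ bot_ne_top]
      · rintro _ ⟨v, rfl⟩
        obtain ⟨u, hu, w, hw⟩ := hrL' _ (h1 v)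
        rw [LinearMap.lsmul_apply, hw, pow_succ', mul_smul]
        refine Submodule.add_mem_sup hu (Submodule.smul_mem_smul ?_ ⟨w, rfl⟩)
        rw [PadicInt.maximalIdeal_eq_span_p]
        exact Ideal.mem_span_singleton_self _
    obtain ⟨k⟩ := key (fun v => hM ⟨v, rfl⟩)
    exact ⟨k.trans e⟩

theorem aux_meas (p : ℕ) [Fact p.Prime] (k : ℕ) (c : ZMod (p ^ k)) :
    IsOpen {x : ℤ_[p] | PadicInt.toZModPow (p := p) k x = c} := by
  rw [Metric.isOpen_iff]
  intro x hx
  have hp : (0 : ℝ) < p := by exact_mod_cast (Fact.out : p.Prime).pos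
  refine ⟨(p : ℝ) ^ (-k : ℤ), zpow_pos hp _, fun y hy => ?_⟩
  rw [Metric.mem_ball, dist_eq_norm] at hy
  have := (PadicInt.norm_le_pow_iff_mem_span_pow _ _).1 hy.le
  rw [← PadicInt.ker_toZModPow, RingHom.mem_ker, map_sub, sub_eq_zero] at this
  exact this.trans hx

theorem aux_prob {E F : Type*} [AddCommGroup E] [MeasurableSpace E] [MeasurableAdd E]
    [AddCommGroup F] [Finite F]
    (μ : Measure E) [IsProbabilityMeasure μ] [μ.IsAddLeftInvariant] (r : E →+ F)
    (hr : Function.Surjective r) (hm : ∀ y, MeasurableSet (r ⁻¹' {y})) (S : Set F) :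
    μ (r ⁻¹' S) = (Nat.card S : ℝ≥0∞) / (Nat.card F : ℝ≥0∞) := by
  classical
  have := Fintype.ofFinite F
  have hc : ∀ y, μ (r ⁻¹' {y}) = μ (r ⁻¹' {0}) := by
    intro y
    obtain ⟨x, rfl⟩ := hr y
    rw [← measure_preimage_add μ x (r ⁻¹' {r x})]
    congr 1
    ext z
    simp
  have hS : ∀ T : Finset F, μ (r ⁻¹' (T : Set F)) = (T.card : ℝ≥0∞) * μ (r ⁻¹' {0}) := by
    intro T
    rw [← sum_measure_preimage_singleton T (fun y _ => hm y), Finset.sum_congr rfl fun y _ => hc y]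
    simp
  have h1 := hS Finset.univ
  rw [Finset.coe_univ, Set.preimage_univ, measure_univ, Finset.card_univ] at h1
  have h2 := hS S.toFinset
  rw [Set.coe_toFinset, Set.toFinset_card] at h2
  rw [h2, Nat.card_eq_fintype_card, Nat.card_eq_fintype_card, div_eq_mul_inv]
  congr 1
  exact ENNReal.eq_inv_of_mul_eq_one_left (by rw [mul_comm]; exact h1.symm)

/-- Lemma 2.1: the Haar probability that `cok(f_j(X)) ≃ G_j` for all `j`, for
Haar-random `X ∈ Mat_n(ℤ_p)`, equals the uniform probability of the corresponding
event over `Mat_n(ℤ/p^{N+1}ℤ)`, whenever `p^N G_j = 0` for all `j`. -/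
theorem stmt_5 (p : ℕ) [Fact p.Prime] (N n l : ℕ) (hl : 1 ≤ l)
    (f : Fin l → Polynomial ℤ_[p]) (hf : ∀ j, (f j).Monic)
    (G : Fin l → Type) [∀ j, AddCommGroup (G j)] [∀ j, Finite (G j)]
    (hG : ∀ (j : Fin l) (x : G j), (p ^ N : ℕ) • x = 0)
    (μ : Measure (Fin n → Fin n → ℤ_[p])) [IsProbabilityMeasure μ]
    [μ.IsAddHaarMeasure] :
    μ {X | ∀ j, Nonempty (((Fin n → ℤ_[p]) ⧸
        LinearMap.range (Polynomial.aeval (Matrix.of X) (f j)).mulVecLin) ≃+ G j)} =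
      (Nat.card {Y : Matrix (Fin n) (Fin n) (ZMod (p ^ (N + 1))) //
          ∀ j, Nonempty (((Fin n → ZMod (p ^ (N + 1))) ⧸ LinearMap.range
            (Polynomial.aeval Y ((f j).map (PadicInt.toZModPow (N + 1)))).mulVecLin) ≃+ G j)}
        : ℝ≥0∞) /
      (Nat.card (Matrix (Fin n) (Fin n) (ZMod (p ^ (N + 1)))) : ℝ≥0∞) := by
  have : BorelSpace ℤ_[p] := ⟨rfl⟩
  have : SecondCountableTopology ℤ_[p] := inferInstance
  let r : (Fin n → Fin n → ℤ_[p]) →+ Matrix (Fin n) (Fin n) (ZMod (p ^ (N + 1))) :=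
    { toFun := fun X => (Matrix.of X).map (PadicInt.toZModPow (p := p) (N + 1))
      map_zero' := by ext i j; simp
      map_add' := fun v w => by ext i j; simp }
  have hr : ∀ X, r X = (Matrix.of X).map (PadicInt.toZModPow (p := p) (N + 1)) := fun _ => rfl
  have hrs : Function.Surjective r := by
    intro Y
    choose g hg using fun i j =>
      ZMod.ringHom_surjective (PadicInt.toZModPow (p := p) (N + 1)) (Y i j)
    refine ⟨g, ?_⟩
    ext i j
    exact hg i j
  have hm : ∀ Y, MeasurableSet (r ⁻¹' {Y}) := by
    intro Y
    have : r ⁻¹' {Y} = ⋂ i, ⋂ j, (fun X : Fin n → Fin n → ℤ_[p] => X i j) ⁻¹'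
        {x | PadicInt.toZModPow (p := p) (N + 1) x = Y i j} := by
      ext X
      simp [hr, ← Matrix.ext_iff]
    rw [this]
    refine MeasurableSet.iInter fun i => MeasurableSet.iInter fun j => ?_
    exact (aux_meas p (N + 1) (Y i j)).measurableSet.preimage (by fun_prop)
  have : NeZero (p ^ (N + 1)) := ⟨pow_ne_zero _ (Fact.out : p.Prime).ne_zero⟩
  have : Finite (Matrix (Fin n) (Fin n) (ZMod (p ^ (N + 1)))) :=
    inferInstanceAs (Finite (Fin n → Fin n → ZMod (p ^ (N + 1))))
  have main := aux_prob μ r hrs hm {Y | ∀ j, Nonempty (((Fin n → ZMod (p ^ (N + 1))) ⧸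
    LinearMap.range (Polynomial.aeval Y
      ((f j).map (PadicInt.toZModPow (N + 1)))).mulVecLin) ≃+ G j)}
  rw [Set.coe_ofPred] at main
  rw [← main]
  congr 1
  ext X
  simp only [Set.mem_ofPred_eq, Set.mem_preimage]
  refine forall_congr' fun j => ?_
  have e : Polynomial.aeval (r X) ((f j).map (PadicInt.toZModPow (N + 1))) =
      (Polynomial.aeval (Matrix.of X) (f j)).map (PadicInt.toZModPow (p := p) (N + 1)) := by
    have := Polynomial.map_aeval_eq_aeval_map (φ := PadicInt.toZModPow (p := p) (N + 1))
      (ψ := (PadicInt.toZModPow (p := p) (N + 1)).mapMatrix) (by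
        ext x i k
        by_cases hik : i = k <;> simp [Matrix.algebraMap_matrix_apply, hik]) (f j) (Matrix.of X)
    exact this.symm
  rw [e]
  exact aux_cok p N n _ (G j) (hG j)
end

section
/- Let $p$ be a prime and $P(t) \in \mathbb{Z}_p[t]$ be a monic polynomial of degree at most $2$ whose reduction mod $p$ is irreducible over $\mathbb{F}_p$; set $q = p^{\deg P}$. Let $G$ be a finite module over $\mathbb{Z}_p[t]/(P(t))$ with $r := \dim_{\mathbb{F}_q}(G/pG)$, and let $N \geq 0$ with $p^N G = 0$. Fix $\bar{X} \in \mathrm{Mat}_n(\mathbb{F}_p)$ with $\dim_{\mathbb{F}_q}(\mathrm{cok}(P(\bar{X}))) = r$. Then the number of $X \in \mathrm{Mat}_n(\mathbb{Z}/p^{N+1}\mathbb{Z})$ with $X \equiv \bar{X} \pmod p$ and $\mathrm{cok}(P(X)) \simeq G$ equals $p^{N n^2} \cdot \frac{q^{r^2}\prod_{i=1}^{r}(1-q^{-i})^2}{|\mathrm{Aut}_{\mathbb{Z}_p[t]/(P(t))}(G)|}$; in particular, it is independent of the choice of $\bar{X}$. -/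
set_option linter.style.haveILetI false

theorem aux_fiber_count {A B : Type*} [AddCommGroup A] [AddCommGroup B]
    (f : A →+ B) (hf : Function.Surjective f) (Q : B → Prop) :
    Nat.card {a // Q (f a)} = Nat.card {b // Q b} * Nat.card f.ker := by
  obtain ⟨s, hs⟩ := hf.hasRightInverse
  rw [← Nat.card_prod]
  refine Nat.card_congr
    { toFun := fun a => (⟨f a.1, a.2⟩, ⟨a.1 - s (f a.1), by simp [AddMonoidHom.mem_ker, hs (f a.1)]⟩)
      invFun := fun b => ⟨b.2.1 + s b.1.1, by
        have := b.2.2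
        rw [AddMonoidHom.mem_ker] at this
        rw [map_add, this, zero_add, hs]; exact b.1.2⟩
      left_inv := fun a => by simp
      right_inv := fun b => by
        have := b.2.2
        rw [AddMonoidHom.mem_ker] at this
        ext <;> simp [this, hs b.1.1] }

theorem aux_fiber_count' {A B : Type*} [AddCommGroup A] [AddCommGroup B]
    (f : A →+ B) (hf : Function.Surjective f) (Q : B → Prop) [Finite A] :
    Nat.card {a // Q (f a)} * Nat.card B = Nat.card {b // Q b} * Nat.card A := by
  have h1 := aux_fiber_count f hf Q
  have h2 := aux_fiber_count f hf (fun _ => True)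
  rw [Nat.card_congr (Equiv.subtypeUnivEquiv (fun _ => trivial)),
    Nat.card_congr (Equiv.subtypeUnivEquiv (fun _ => trivial))] at h2
  rw [h1, h2]; ring

theorem aux_nak {R M : Type*} [CommRing R] [IsLocalRing R] [AddCommGroup M] [Module R M]
    {π : R} (hπ : ¬ IsUnit π) {N N' : Submodule R M} (hfg : N'.FG)
    (h : ∀ x ∈ N', ∃ y ∈ N, ∃ z ∈ N', x = y + π • z) : N' ≤ N := by
  refine Submodule.le_of_le_smul_of_le_jacobson_bot (I := Ideal.span {π}) hfg ?_ ?_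
  · rw [IsLocalRing.jacobson_eq_maximalIdeal _ bot_ne_top, Ideal.span_le]
    simpa using hπ
  · intro x hx
    obtain ⟨y, hy, z, hz, rfl⟩ := h x hx
    exact Submodule.add_mem_sup hy
      (Submodule.smul_mem_smul (Ideal.mem_span_singleton_self π) hz)

/-- `F` surjective with kernel `A E + π^(N+1) E` iff conditions. -/
theorem aux_claimII {R G E : Type*} [CommRing R] [IsLocalRing R] [IsNoetherianRing R]
    [AddCommGroup G] [Module R G] [Finite G] [AddCommGroup E] [Module R E] [Module.Finite R E]
    {π : R} (hπ : ¬ IsUnit π) (N : ℕ) (hN : ∀ x : G, π ^ N • x = 0)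
    (A : E →ₗ[R] E) (F : E →ₗ[R] G)
    [Finite (E ⧸ (LinearMap.range A ⊔ LinearMap.range (LinearMap.lsmul R E π)))]
    (hcard : Nat.card (E ⧸ (LinearMap.range A ⊔ LinearMap.range (LinearMap.lsmul R E π))) =
      Nat.card (G ⧸ LinearMap.range (LinearMap.lsmul R G π))) :
    (Function.Surjective F ∧ LinearMap.ker F =
      LinearMap.range A ⊔ LinearMap.range (LinearMap.lsmul R E (π ^ (N+1)))) ↔
    ((∀ x, F (A x) = 0) ∧ (∀ g, ∃ x g', g = F x + π • g') ∧
      (∀ g, π • g = 0 → ∃ w h, A w = π • h ∧ F h = g)) := by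
  haveI : IsNoetherian R E := inferInstance
  constructor
  · rintro ⟨hs, hk⟩
    have hA : ∀ x, F (A x) = 0 := fun x => by
      rw [← LinearMap.mem_ker, hk]
      exact Submodule.mem_sup_left ⟨x, rfl⟩
    refine ⟨hA, fun g => ?_, fun g hg => ?_⟩
    · obtain ⟨x, rfl⟩ := hs g
      exact ⟨x, 0, by simp⟩
    · have key : LinearMap.range (LinearMap.lsmul R E (π ^ N)) ≤ LinearMap.range A := by
        refine aux_nak hπ (IsNoetherian.noetherian _) ?_
        rintro _ ⟨x, rfl⟩
        have : (LinearMap.lsmul R E (π ^ N)) x ∈ LinearMap.ker F := by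
          simp [hN]
        rw [hk] at this
        obtain ⟨y, hy, _, ⟨z, rfl⟩, h⟩ := Submodule.mem_sup.1 this
        refine ⟨y, hy, _, ⟨z, rfl⟩, ?_⟩
        rw [← h]; simp [pow_succ', mul_smul]
      have hk' : LinearMap.ker F ≤ LinearMap.range A := by
        rw [hk]
        refine sup_le le_rfl (le_trans ?_ key)
        rintro _ ⟨x, rfl⟩
        exact ⟨π • x, by simp only [LinearMap.lsmul_apply, pow_succ, mul_smul]⟩
      obtain ⟨h, rfl⟩ := hs g
      have : π • h ∈ LinearMap.ker F := by simpa using hg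
      obtain ⟨w, hw⟩ := hk' this
      exact ⟨w, h, hw, rfl⟩
  · rintro ⟨h1, h2, h3⟩
    have hs : Function.Surjective F := by
      rw [← LinearMap.range_eq_top, eq_top_iff]
      refine aux_nak hπ (IsNoetherian.noetherian _) ?_
      intro g _
      obtain ⟨x, g', h⟩ := h2 g
      exact ⟨F x, ⟨x, rfl⟩, g', trivial, h⟩
    have hle : LinearMap.range A ⊔ LinearMap.range (LinearMap.lsmul R E π) ≤
        (LinearMap.range (LinearMap.lsmul R G π)).comap F := by
      refine sup_le ?_ ?_
      · rintro _ ⟨x, rfl⟩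
        simp [h1]
      · rintro _ ⟨x, rfl⟩
        exact ⟨F x, by simp⟩
    have hbij : Function.Bijective (Submodule.mapQ _ _ F hle) := by
      refine (Nat.bijective_iff_surjective_and_card _).2 ⟨?_, hcard⟩
      intro g
      obtain ⟨g, rfl⟩ := Submodule.Quotient.mk_surjective _ g
      obtain ⟨x, rfl⟩ := hs g
      exact ⟨Submodule.Quotient.mk x, by simp⟩
    have hker : LinearMap.ker F ≤ LinearMap.range A := by
      refine aux_nak hπ (IsNoetherian.noetherian _) ?_
      intro x hx
      have hx' : x ∈ LinearMap.range A ⊔ LinearMap.range (LinearMap.lsmul R E π) := by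
        rw [← Submodule.Quotient.mk_eq_zero]
        apply hbij.1
        rw [map_zero, Submodule.mapQ_apply, LinearMap.mem_ker.1 hx, Submodule.Quotient.mk_zero]
      obtain ⟨_, ⟨u, rfl⟩, _, ⟨x1, rfl⟩, hxx⟩ := Submodule.mem_sup.1 hx'
      have : π • F x1 = 0 := by
        have := LinearMap.mem_ker.1 hx
        rw [← hxx] at this
        simpa [h1] using this
      obtain ⟨w, h, hw, hh⟩ := h3 _ this
      refine ⟨A (u + w), ⟨_, rfl⟩, x1 - h, by simp [hh], ?_⟩
      rw [← hxx, map_add, hw, smul_sub]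
      simp
    refine ⟨hs, le_antisymm (hker.trans le_sup_left) (sup_le ?_ ?_)⟩
    · rintro _ ⟨x, rfl⟩
      simp [h1]
    · rintro _ ⟨x, rfl⟩
      simp [pow_succ', mul_smul, hN]

/-- spanning tuples in `V` with `π V = 0`. -/
theorem aux_tuples {R V : Type*} [CommRing R] [AddCommGroup V] [Module R V] [Finite V]
    {π : R} [hmax : (Ideal.span {π}).IsMaximal] (hV : ∀ v : V, π • v = 0) {q r : ℕ} (hq1 : 1 < q)
    (hq : Nat.card (R ⧸ Ideal.span {π}) = q) (hr : Nat.card V = q ^ r) :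
    Nat.card {s : Fin r → V // Submodule.span R (Set.range s) = ⊤} =
      ∏ i : Fin r, (q ^ r - q ^ (i : ℕ)) := by
  letI : Field (R ⧸ Ideal.span {π}) := Ideal.Quotient.field _
  haveI : Finite (R ⧸ Ideal.span {π}) := Nat.finite_of_card_ne_zero (by omega)
  letI := Fintype.ofFinite (R ⧸ Ideal.span {π})
  have hT : Module.IsTorsionBySet R V (Ideal.span {π} : Ideal R) := by
    rintro v ⟨a, ha⟩
    obtain ⟨b, rfl⟩ := Ideal.mem_span_singleton'.1 ha
    simp [mul_smul, hV]
  letI : Module (R ⧸ Ideal.span {π}) V := hT.module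
  haveI : IsScalarTower R (R ⧸ Ideal.span {π}) V := hT.isScalarTower
  letI := Fintype.ofFinite V
  have hfr : Module.finrank (R ⧸ Ideal.span {π}) V = r := by
    have := Module.card_eq_pow_finrank (K := R ⧸ Ideal.span {π}) (V := V)
    rw [← Nat.card_eq_fintype_card, ← Nat.card_eq_fintype_card, hr, hq] at this
    exact (Nat.pow_right_injective hq1 this).symm
  have hc := card_linearIndependent (K := R ⧸ Ideal.span {π}) (V := V) (k := r) hfr.ge
  rw [hfr, ← Nat.card_eq_fintype_card, hq] at hc
  rw [← hc]
  refine Nat.card_congr (Equiv.subtypeEquivRight fun s => ?_)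
  rw [linearIndependent_iff_card_eq_finrank_span, Fintype.card_fin]
  have hsp : (Submodule.span (R ⧸ Ideal.span {π}) (Set.range s)).restrictScalars R =
      Submodule.span R (Set.range s) := 
    Submodule.restrictScalars_span R (R ⧸ Ideal.span {π}) Ideal.Quotient.mk_surjective _
  rw [← hsp, Submodule.restrictScalars_eq_top_iff]
  constructor
  · intro h
    rw [Set.finrank, h, finrank_top, hfr]
  · intro h
    exact Submodule.eq_top_of_finrank_eq (by rw [hfr]; exact h.symm)

theorem aux_basis {R U : Type*} [CommRing R] [AddCommGroup U] [Module R U]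
    {π : R} [hmax : (Ideal.span {π}).IsMaximal] (hU : ∀ v : U, π • v = 0) {q r : ℕ} (hq1 : 1 < q)
    (hq : Nat.card (R ⧸ Ideal.span {π}) = q) (V : Submodule R U) (hr : Nat.card V = q ^ r) :
    ∃ v : Fin r → U, Submodule.span R (Set.range v) = V ∧
      ∀ (W : Type) [AddCommGroup W] [Module R W], (∀ w : W, π • w = 0) → ∀ w : Fin r → W,
        ∃ f : U →ₗ[R] W, ∀ i, f (v i) = w i := by
  letI : Field (R ⧸ Ideal.span {π}) := Ideal.Quotient.field _
  haveI : Finite (R ⧸ Ideal.span {π}) := Nat.finite_of_card_ne_zero (by omega)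
  letI := Fintype.ofFinite (R ⧸ Ideal.span {π})
  have hT : ∀ (V : Type _) [AddCommGroup V] [Module R V], (∀ v : V, π • v = 0) →
      Module.IsTorsionBySet R V (Ideal.span {π} : Ideal R) := by
    rintro V _ _ hV v ⟨a, ha⟩
    obtain ⟨b, rfl⟩ := Ideal.mem_span_singleton'.1 ha
    simp [mul_smul, hV]
  have hT' : ∀ (V : Type) [AddCommGroup V] [Module R V], (∀ v : V, π • v = 0) →
      Module.IsTorsionBySet R V (Ideal.span {π} : Ideal R) := by
    rintro V _ _ hV v ⟨a, ha⟩
    obtain ⟨b, rfl⟩ := Ideal.mem_span_singleton'.1 ha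
    simp [mul_smul, hV]
  letI : Module (R ⧸ Ideal.span {π}) U := (hT U hU).module
  haveI : IsScalarTower R (R ⧸ Ideal.span {π}) U := (hT U hU).isScalarTower
  have hVf : Finite V := Nat.finite_of_card_ne_zero (by rw [hr]; positivity)
  let V' : Submodule (R ⧸ Ideal.span {π}) U :=
    { V.toAddSubmonoid with
      smul_mem' := by
        intro c x hx
        obtain ⟨c, rfl⟩ := Ideal.Quotient.mk_surjective c
        exact V.smul_mem c hx }
  have hVV : (V' : Set U) = V := rfl
  haveI : Finite V' := hVf
  letI := Fintype.ofFinite V'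
  have hfr : Module.finrank (R ⧸ Ideal.span {π}) V' = r := by
    have := Module.card_eq_pow_finrank (K := R ⧸ Ideal.span {π}) (V := V')
    rw [← Nat.card_eq_fintype_card, ← Nat.card_eq_fintype_card,
      show Nat.card V' = q ^ r from hr, hq] at this
    exact (Nat.pow_right_injective hq1 this).symm
  let b := Module.finBasisOfFinrankEq (R ⧸ Ideal.span {π}) V' hfr
  refine ⟨fun i => (b i : U), ?_, ?_⟩
  · have hsp := Submodule.restrictScalars_span R (R ⧸ Ideal.span {π})
      Ideal.Quotient.mk_surjective (Set.range fun i => (b i : U))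
    rw [← hsp]
    have : Set.range (fun i => (b i : U)) = V'.subtype '' (Set.range b) := by
      rw [← Set.range_comp]; rfl
    rw [this, Submodule.span_image, b.span_eq, Submodule.map_top, Submodule.range_subtype]
    ext x
    rfl
  · intro W _ _ hW w
    letI : Module (R ⧸ Ideal.span {π}) W := (hT' W hW).module
    haveI : IsScalarTower R (R ⧸ Ideal.span {π}) W := (hT' W hW).isScalarTower
    obtain ⟨g, hg⟩ := LinearMap.exists_extend (b.constr ℕ w)
    refine ⟨g.restrictScalars R, fun i => ?_⟩
    have := LinearMap.congr_fun hg (b i)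
    simpa using this

theorem aux_countPsi {R G : Type} [CommRing R] [IsDomain R]
    [AddCommGroup G] [Module R G] [Finite G] {n : ℕ}
    {π : R} (hπ0 : π ≠ 0) [hmax : (Ideal.span {π}).IsMaximal]
    {q r : ℕ} (hq1 : 1 < q)
    (hq : Nat.card (R ⧸ Ideal.span {π}) = q)
    (A : (Fin n → R) →ₗ[R] (Fin n → R)) (F : (Fin n → R) →ₗ[R] G)
    (hG : Nat.card (LinearMap.ker (LinearMap.lsmul R G π)) = q ^ r)
    (V : Submodule R ((Fin n → R) ⧸ LinearMap.range (LinearMap.lsmul R (Fin n → R) π)))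
    (hV : Nat.card V = q ^ r)
    (hVA : ∀ x, Submodule.Quotient.mk x ∈ V ↔ ∃ y, A x = π • y)
    (Φ0 : (Fin n → R) →ₗ[R] G) (hΦ0 : ∀ x, F (A x) + π • Φ0 x = 0) :
    Nat.card {Φ : (Fin n → R) →ₗ[R] G // (∀ x, F (A x) + π • Φ x = 0) ∧
      ∀ g, π • g = 0 → ∃ w h, A w = π • h ∧ F h + Φ w = g} * (q ^ r) ^ r =
    (∏ i : Fin r, (q ^ r - q ^ (i : ℕ))) * (q ^ r) ^ n := by
  have hU : ∀ v : ((Fin n → R) ⧸ LinearMap.range (LinearMap.lsmul R (Fin n → R) π)),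
      π • v = 0 := by
    intro v
    obtain ⟨v, rfl⟩ := Submodule.Quotient.mk_surjective _ v
    rw [← Submodule.Quotient.mk_smul, Submodule.Quotient.mk_eq_zero]
    exact ⟨v, rfl⟩
  obtain ⟨v, hv, hext⟩ := aux_basis hU hq1 hq V hV
  have hw : ∀ i, ∃ w h, Submodule.Quotient.mk w = v i ∧ A w = π • h := by
    intro i
    obtain ⟨w, hw⟩ := Submodule.Quotient.mk_surjective _ (v i)
    have : Submodule.Quotient.mk w ∈ V := by
      rw [hw, ← hv]; exact Submodule.subset_span ⟨i, rfl⟩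
    obtain ⟨h, hh⟩ := (hVA w).1 this
    exact ⟨w, h, hw, hh⟩
  choose w h hwv hwh using hw
  set T := LinearMap.ker (LinearMap.lsmul R G π) with hTdef
  have hT : ∀ g : G, g ∈ T ↔ π • g = 0 := fun g => by simp [hTdef]
  let c0 : Fin r → T := fun i => ⟨F (h i) + Φ0 (w i), by
    rw [hT, smul_add, ← map_smul, ← hwh, hΦ0]⟩
  let e : ((Fin n → R) →ₗ[R] T) →+ (Fin r → T) :=
    { toFun := fun Ψ i => Ψ (w i)
      map_zero' := rfl
      map_add' := fun _ _ => rfl }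
  have he : Function.Surjective e := by
    intro c
    obtain ⟨f, hf⟩ := hext T (fun t => by ext; simpa using (hT _).1 t.2) c
    refine ⟨f.comp (Submodule.mkQ _), ?_⟩
    ext i
    simp [e, hwv, hf]
  have hfin : Finite ((Fin n → R) →ₗ[R] T) :=
    Finite.of_equiv _ ((Pi.basisFun R (Fin n)).constr ℕ (M' := T)).toEquiv
  have hcardHom : Nat.card ((Fin n → R) →ₗ[R] T) = (q ^ r) ^ n := by
    rw [← Nat.card_congr ((Pi.basisFun R (Fin n)).constr ℕ (M' := T)).toEquiv]
    rw [Nat.card_fun, hG, Nat.card_fin]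
  have h1 := aux_fiber_count' e he (fun c => Submodule.span R (Set.range (c0 + c)) = ⊤)
  have h2 : Nat.card {c : Fin r → T // Submodule.span R (Set.range (c0 + c)) = ⊤} =
      Nat.card {c : Fin r → T // Submodule.span R (Set.range c) = ⊤} :=
    Nat.card_congr ((Equiv.addLeft c0).subtypeEquiv (fun _ => Iff.rfl))
  rw [h2, aux_tuples (π := π) (fun t => by ext; simpa using (hT _).1 t.2) hq1 hq hG, hcardHom]
    at h1
  rw [← h1]
  have : Nat.card (Fin r → T) = (q ^ r) ^ r := by rw [Nat.card_fun, hG, Nat.card_fin]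
  rw [this]
  congr 1
  have hspan : ∀ (Ψ : (Fin n → R) →ₗ[R] T),
      Submodule.span R (Set.range (c0 + e Ψ)) = ⊤ ↔
      ∀ g, π • g = 0 → ∃ w h, A w = π • h ∧ F h + (Φ0 w + Ψ w) = g := by
    intro Ψ
    constructor
    · intro hs g hg
      have : (⟨g, (hT g).2 hg⟩ : T) ∈ Submodule.span R (Set.range (c0 + e Ψ)) := by
        rw [hs]; trivial
      obtain ⟨a, ha⟩ := (Submodule.mem_span_range_iff_exists_fun R).1 this
      refine ⟨∑ i, a i • w i, ∑ i, a i • h i, ?_, ?_⟩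
      · simp only [map_sum, map_smul, hwh, Finset.smul_sum]
        exact Finset.sum_congr rfl fun i _ => smul_comm _ _ _
      · have := congrArg Subtype.val ha
        simp only at this
        rw [← this]
        simp only [map_sum, map_smul]
        rw [Submodule.coe_sum, Submodule.coe_sum, ← Finset.sum_add_distrib,
          ← Finset.sum_add_distrib]
        refine Finset.sum_congr rfl fun i _ => ?_
        simp [c0, e, smul_add, add_assoc]
    · intro hs
      rw [eq_top_iff]
      rintro ⟨g, hg⟩ -
      obtain ⟨x, y, hxy, hg'⟩ := hs g ((hT g).1 hg)
      have hxV : Submodule.Quotient.mk x ∈ V := (hVA x).2 ⟨y, hxy⟩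
      rw [← hv] at hxV
      obtain ⟨a, ha⟩ := (Submodule.mem_span_range_iff_exists_fun R).1 hxV
      refine (Submodule.mem_span_range_iff_exists_fun R).2 ⟨a, ?_⟩
      have hx : Submodule.Quotient.mk (p := LinearMap.range (LinearMap.lsmul R (Fin n → R) π))
          (x - ∑ i, a i • w i) = 0 := by
        rw [← Submodule.mkQ_apply, map_sub, map_sum, Submodule.mkQ_apply, ← ha, sub_eq_zero]
        refine Finset.sum_congr rfl fun i _ => ?_
        rw [map_smul, Submodule.mkQ_apply, hwv]
      rw [Submodule.Quotient.mk_eq_zero] at hx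
      obtain ⟨u, hu⟩ := hx
      have hx' : x = ∑ i, a i • w i + π • u := by
        rw [eq_add_of_sub_eq hu.symm, add_comm]; rfl
      have hy : y = ∑ i, a i • h i + A u := by
        have : π • y = π • (∑ i, a i • h i + A u) := by
          rw [← hxy, hx']
          simp only [map_add, map_sum, map_smul, hwh, Finset.smul_sum, smul_add]
          congr 1
          exact Finset.sum_congr rfl fun i _ => smul_comm _ _ _
        exact smul_right_injective _ hπ0 this
      ext
      simp only
      rw [← hg', hy, hx']
      have hz : F (A u) + (π • Φ0 u + ((π • Ψ u : T) : G)) = 0 := by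
        rw [show π • Ψ u = 0 by ext; simpa using (hT _).1 (Ψ u).2, ← add_assoc, hΦ0]; simp
      simp only [map_add, map_sum, map_smul]
      rw [Submodule.coe_sum, Submodule.coe_add, Submodule.coe_sum]
      have : ∀ a b c d e f : G, d + (e + f) = 0 → (a + d) + ((b + e) + (c + f)) = a + b + c := by
        intro a b c d e f h
        have : (a + d) + ((b + e) + (c + f)) = a + b + c + (d + (e + f)) := by abel
        rw [this, h, add_zero]
      rw [this _ _ _ _ _ _ hz, ← Finset.sum_add_distrib,
          ← Finset.sum_add_distrib]
      refine Finset.sum_congr rfl fun i _ => ?_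
      simp [c0, e, smul_add, add_assoc]
  refine Nat.card_congr (Equiv.symm ?_)
  refine Equiv.ofBijective (fun Ψ => ⟨Φ0 + T.subtype.comp Ψ.1, ?_, ?_⟩) ⟨?_, ?_⟩
  · intro x
    have := (hT _).1 (Ψ.1 x).2
    simp only [LinearMap.add_apply, LinearMap.comp_apply, Submodule.subtype_apply, smul_add,
      this, add_zero, hΦ0]
  · exact (hspan Ψ.1).1 Ψ.2
  · intro Ψ Ψ' hh
    have := congrArg Subtype.val hh
    simp only [add_right_inj] at this
    ext i : 3
    have := LinearMap.congr_fun this (Pi.single i 1)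
    simpa using this
  · rintro ⟨Φ, h1, h2⟩
    refine ⟨⟨(Φ - Φ0).codRestrict T (fun x => ?_), ?_⟩, ?_⟩
    · rw [hT, LinearMap.sub_apply, smul_sub]
      have := h1 x
      rw [← hΦ0 x] at this
      rw [add_left_cancel this, sub_self]
    · rw [hspan]
      simpa using h2
    · ext; simp

theorem aux_countF {R G : Type} [CommRing R]
    [AddCommGroup G] [Module R G] [Finite G] {n : ℕ}
    {π : R} [hmax : (Ideal.span {π}).IsMaximal]
    {q r : ℕ} (hq1 : 1 < q)
    (hq : Nat.card (R ⧸ Ideal.span {π}) = q)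
    (A : (Fin n → R) →ₗ[R] (Fin n → R))
    (hG : Nat.card (G ⧸ LinearMap.range (LinearMap.lsmul R G π)) = q ^ r)
    (hA : Nat.card ((Fin n → R) ⧸
      (LinearMap.range A ⊔ LinearMap.range (LinearMap.lsmul R (Fin n → R) π))) = q ^ r) :
    Nat.card {F : (Fin n → R) →ₗ[R] G // (∀ x, ∃ g, F (A x) = π • g) ∧
      ∀ g, ∃ x g', g = F x + π • g'} =
    (∏ i : Fin r, (q ^ r - q ^ (i : ℕ))) *
      (Nat.card (LinearMap.range (LinearMap.lsmul R G π))) ^ n := by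
  set L := LinearMap.range A ⊔ LinearMap.range (LinearMap.lsmul R (Fin n → R) π) with hL
  set T := LinearMap.range (LinearMap.lsmul R G π) with hTdef
  have hT : ∀ g : G, g ∈ T ↔ ∃ g', g = π • g' := fun g => by
    simp [hTdef, eq_comm]
  have hU : ∀ v : (Fin n → R) ⧸ L, π • v = 0 := by
    intro v
    obtain ⟨v, rfl⟩ := Submodule.Quotient.mk_surjective _ v
    rw [← Submodule.Quotient.mk_smul, Submodule.Quotient.mk_eq_zero]
    exact Submodule.mem_sup_right ⟨v, rfl⟩
  have hW : ∀ v : G ⧸ T, π • v = 0 := by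
    intro v
    obtain ⟨v, rfl⟩ := Submodule.Quotient.mk_surjective _ v
    rw [← Submodule.Quotient.mk_smul, Submodule.Quotient.mk_eq_zero]
    exact ⟨v, rfl⟩
  have hA' : Nat.card (⊤ : Submodule R ((Fin n → R) ⧸ L)) = q ^ r := by
    rw [← hA]; exact Nat.card_congr Submodule.topEquiv.toEquiv
  obtain ⟨v, hv, hext⟩ := aux_basis hU hq1 hq ⊤ hA'
  choose x hx using fun i => Submodule.Quotient.mk_surjective _ (v i)
  have hdec : ∀ y, ∃ (a : Fin r → R) (u z : Fin n → R), y = ∑ i, a i • x i + A u + π • z := by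
    intro y
    have : (Submodule.Quotient.mk y : (Fin n → R) ⧸ L) ∈ Submodule.span R (Set.range v) := by
      rw [hv]; trivial
    obtain ⟨a, ha⟩ := (Submodule.mem_span_range_iff_exists_fun R).1 this
    have hy : (Submodule.Quotient.mk (y - ∑ i, a i • x i) : (Fin n → R) ⧸ L) = 0 := by
      rw [← Submodule.mkQ_apply, map_sub, map_sum, Submodule.mkQ_apply, ← ha, sub_eq_zero]
      refine Finset.sum_congr rfl fun i _ => ?_
      rw [map_smul, Submodule.mkQ_apply, hx]
    rw [Submodule.Quotient.mk_eq_zero, hL] at hy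
    obtain ⟨_, ⟨u, rfl⟩, _, ⟨z, rfl⟩, h⟩ := Submodule.mem_sup.1 hy
    refine ⟨a, u, z, ?_⟩
    have h' : A u + π • z = y - ∑ i, a i • x i := h
    rw [add_assoc, h']; abel
  let K : AddSubgroup ((Fin n → R) →ₗ[R] G) :=
    { carrier := {F | ∀ x, F (A x) ∈ T}
      zero_mem' := fun x => by simp
      add_mem' := fun {a b} ha hb x => T.add_mem (ha x) (hb x)
      neg_mem' := fun {a} ha x => T.neg_mem (ha x) }
  let e : K →+ (Fin r → G ⧸ T) :=
    { toFun := fun F i => Submodule.Quotient.mk (F.1 (x i))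
      map_zero' := by ext; simp
      map_add' := fun a b => by ext; simp }
  have he : Function.Surjective e := by
    intro c
    obtain ⟨f, hf⟩ := hext (G ⧸ T) hW c
    obtain ⟨F, hF⟩ := Module.projective_lifting_property T.mkQ (f.comp L.mkQ) T.mkQ_surjective
    refine ⟨⟨F, fun y => ?_⟩, ?_⟩
    · have := LinearMap.congr_fun hF (A y)
      rw [LinearMap.comp_apply, LinearMap.comp_apply, Submodule.mkQ_apply, Submodule.mkQ_apply,
        (Submodule.Quotient.mk_eq_zero L).2 (Submodule.mem_sup_left ⟨y, rfl⟩), map_zero,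
        Submodule.Quotient.mk_eq_zero] at this
      exact this
    · ext i
      have := LinearMap.congr_fun hF (x i)
      rw [LinearMap.comp_apply, LinearMap.comp_apply, Submodule.mkQ_apply, Submodule.mkQ_apply,
        hx, hf] at this
      exact this
  have hfinW : Finite (G ⧸ T) := Finite.of_surjective _ T.mkQ_surjective
  have h1 := aux_fiber_count e he (fun c => Submodule.span R (Set.range c) = ⊤)
  rw [aux_tuples (π := π) hW hq1 hq hG] at h1
  have hker : Nat.card e.ker = Nat.card T ^ n := by
    have : Nat.card ((Fin n → R) →ₗ[R] T) = Nat.card T ^ n := by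
      rw [← Nat.card_congr ((Pi.basisFun R (Fin n)).constr ℕ (M' := T)).toEquiv]
      rw [Nat.card_fun, Nat.card_fin]
    rw [← this]
    have hmem : ∀ F : e.ker, ∀ y, F.1.1 y ∈ T := by
      intro F y
      obtain ⟨a, u, z, rfl⟩ := hdec y
      simp only [map_add, map_sum, map_smul]
      refine T.add_mem (T.add_mem (T.sum_mem fun i _ => T.smul_mem _ ?_) (F.1.2 u)) ⟨_, rfl⟩
      have := congrFun (AddMonoidHom.mem_ker.1 F.2) i
      exact (Submodule.Quotient.mk_eq_zero T).1 this
    refine Nat.card_congr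
      { toFun := fun F => F.1.1.codRestrict T (hmem F)
        invFun := fun f => ⟨⟨T.subtype.comp f, fun y => (f _).2⟩, ?_⟩
        left_inv := fun F => by ext; rfl
        right_inv := fun F => by ext; rfl }
    rw [AddMonoidHom.mem_ker]
    ext i
    exact (Submodule.Quotient.mk_eq_zero T).2 (f (x i)).2
  rw [hker] at h1
  rw [← h1]
  have hspan : ∀ F : K, Submodule.span R (Set.range (e F)) = ⊤ ↔
      ∀ g, ∃ x g', g = F.1 x + π • g' := by
    intro F
    constructor
    · intro hs g
      have : (Submodule.Quotient.mk g : G ⧸ T) ∈ Submodule.span R (Set.range (e F)) := by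
        rw [hs]; trivial
      obtain ⟨a, ha⟩ := (Submodule.mem_span_range_iff_exists_fun R).1 this
      have hy : (Submodule.Quotient.mk (g - F.1 (∑ i, a i • x i)) : G ⧸ T) = 0 := by
        rw [← Submodule.mkQ_apply, map_sub, map_sum, map_sum, Submodule.mkQ_apply, ← ha,
          sub_eq_zero]
        refine Finset.sum_congr rfl fun i _ => ?_
        rw [map_smul, map_smul]; rfl
      rw [Submodule.Quotient.mk_eq_zero, hT] at hy
      obtain ⟨g', hg'⟩ := hy
      exact ⟨_, g', by rw [← hg']; abel⟩
    · intro hs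
      rw [eq_top_iff]
      rintro g -
      obtain ⟨g, rfl⟩ := Submodule.Quotient.mk_surjective _ g
      obtain ⟨y, g', rfl⟩ := hs g
      obtain ⟨a, u, z, rfl⟩ := hdec y
      refine (Submodule.mem_span_range_iff_exists_fun R).2 ⟨a, ?_⟩
      have h1 : T.mkQ (F.1 (A u)) = 0 := (Submodule.Quotient.mk_eq_zero T).2 (F.2 u)
      rw [← Submodule.mkQ_apply]
      simp only [map_add, map_sum, map_smul, h1, hW, add_zero]
      rfl
  refine Nat.card_congr
    { toFun := fun F => ⟨⟨F.1, fun x => (hT _).2 (F.2.1 x)⟩, (hspan _).2 F.2.2⟩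
      invFun := fun F => ⟨F.1.1, fun x => (hT _).1 (F.1.2 x), (hspan _).1 F.2⟩
      left_inv := fun F => rfl
      right_inv := fun F => rfl }

theorem aux_autcount {R G E : Type*} [CommRing R] [AddCommGroup G] [Module R G] [Finite G]
    [AddCommGroup E] [Module R E] {ι : Type*} [Finite ι] (L : ι → Submodule R E)
    [Finite (E →ₗ[R] G)] :
    Nat.card {x : ι × (E →ₗ[R] G) // Function.Surjective x.2 ∧ LinearMap.ker x.2 = L x.1} =
      Nat.card {i // Nonempty ((E ⧸ L i) ≃ₗ[R] G)} * Nat.card (G ≃ₗ[R] G) := by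
  rw [← Nat.card_prod]
  have hker : ∀ i : {i // Nonempty ((E ⧸ L i) ≃ₗ[R] G)},
      LinearMap.ker ((i.2.some.toLinearMap).comp (L i.1).mkQ) = L i.1 := by
    intro i
    rw [LinearMap.ker_comp, LinearEquiv.ker, Submodule.comap_bot, Submodule.ker_mkQ]
  let f : {i // Nonempty ((E ⧸ L i) ≃ₗ[R] G)} × (G ≃ₗ[R] G) →
      {x : ι × (E →ₗ[R] G) // Function.Surjective x.2 ∧ LinearMap.ker x.2 = L x.1} :=
    fun x => ⟨(x.1.1, (x.2.toLinearMap).comp ((x.1.2.some.toLinearMap).comp (L x.1.1).mkQ)),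
      x.2.surjective.comp (x.1.2.some.surjective.comp (L x.1.1).mkQ_surjective),
      by rw [LinearMap.ker_comp, LinearEquiv.ker, Submodule.comap_bot, hker]⟩
  refine (Nat.card_congr (Equiv.ofBijective f ⟨?_, ?_⟩)).symm
  · rintro ⟨i, α⟩ ⟨j, β⟩ h
    have h1 := congrArg (fun z => z.1.1) h
    have h2 := congrArg (fun z => z.1.2) h
    simp only [f] at h1 h2
    obtain rfl : i = j := Subtype.ext h1
    congr 1
    ext g
    obtain ⟨x, rfl⟩ := (i.2.some.surjective.comp (L i.1).mkQ_surjective) g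
    exact LinearMap.congr_fun h2 x
  · rintro ⟨⟨i, F⟩, hs, hk⟩
    simp only at hs hk
    have hi : Nonempty ((E ⧸ L i) ≃ₗ[R] G) := by
      rw [← hk]
      exact ⟨F.quotKerEquivOfSurjective hs⟩
    let f' : (E ⧸ L i) ≃ₗ[R] G := (Submodule.quotEquivOfEq _ _ hk.symm).trans
      (F.quotKerEquivOfSurjective hs)
    refine ⟨⟨⟨i, hi⟩, hi.some.symm.trans f'⟩, ?_⟩
    ext x
    · rfl
    · simp [f, f']

theorem aux_card_ker {R E : Type*} [CommRing R] [AddCommGroup E] [Module R E] [Finite E]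
    (f : E →ₗ[R] E) : Nat.card (LinearMap.ker f) = Nat.card (E ⧸ LinearMap.range f) := by
  have h1 := Submodule.card_eq_card_quotient_mul_card (LinearMap.ker f)
  have h2 := Submodule.card_eq_card_quotient_mul_card (LinearMap.range f)
  rw [Nat.card_congr f.quotKerEquivRange.toEquiv] at h1
  rw [h1, mul_comm] at h2
  have : Nat.card (LinearMap.range f) ≠ 0 := Nat.card_pos.ne'
  exact Nat.eq_of_mul_eq_mul_left (Nat.pos_of_ne_zero this) h2

theorem aux_finite_quot {R : Type*} [CommRing R] (π : R) (n : ℕ) [Finite (R ⧸ Ideal.span {π})] :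
    Finite ((Fin n → R) ⧸ LinearMap.range (LinearMap.lsmul R (Fin n → R) π)) := by
  refine Finite.of_surjective (α := Fin n → R ⧸ Ideal.span {π})
    (fun y => Submodule.Quotient.mk (fun i => (y i).out)) ?_
  intro x
  obtain ⟨x, rfl⟩ := Submodule.Quotient.mk_surjective _ x
  refine ⟨fun i => Ideal.Quotient.mk _ (x i), ?_⟩
  rw [Submodule.Quotient.eq]
  have : ∀ i, ∃ a, π * a = (Quotient.out (Ideal.Quotient.mk (Ideal.span {π}) (x i))) - x i := by
    intro i
    have : (Quotient.out (Ideal.Quotient.mk (Ideal.span {π}) (x i))) - x i ∈ Ideal.span {π} := by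
      rw [← Ideal.Quotient.eq, Ideal.Quotient.mk_out]
    obtain ⟨a, ha⟩ := Ideal.mem_span_singleton'.1 this
    exact ⟨a, by rw [mul_comm, ha]⟩
  choose a ha using this
  exact ⟨a, by ext i; simpa using ha i⟩

theorem aux_J {R G : Type*} [CommRing R] [AddCommGroup G] [Module R G] {n : ℕ} (p : ℕ) (t : R)
    (hgen : ∀ S : Subring R, t ∈ S → (∀ a, (p : R) * a ∈ S) → S = ⊤)
    (N : ℕ) (hN : ∀ x : G, (p : R) ^ N • x = 0)
    (M : Matrix (Fin n) (Fin n) ℕ)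
    (F : (Fin n → R) →ₗ[R] G)
    (h1 : ∀ x, ∃ g, F (((M.map (Nat.cast : ℕ → R)).mulVecLin - t • LinearMap.id :
      (Fin n → R) →ₗ[R] (Fin n → R)) x) = (p : R) • g)
    (h2 : ∀ g, ∃ x g', g = F x + (p : R) • g') :
    AddSubgroup.closure (Set.range fun i => F (Pi.single i 1)) = ⊤ := by
  set J := AddSubgroup.closure (Set.range fun i => F (Pi.single i 1)) with hJ
  have hJm : ∀ i, F (Pi.single i 1) ∈ J := fun i => AddSubgroup.subset_closure ⟨i, rfl⟩
  let D : AddSubgroup G := (LinearMap.range (LinearMap.lsmul R G (p : R))).toAddSubgroup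
  have hD : ∀ g, (p : R) • g ∈ D := fun g => ⟨g, rfl⟩
  let S : Subring R :=
    { carrier := {a | ∀ x ∈ J ⊔ D, a • x ∈ J ⊔ D}
      mul_mem' := fun {a b} ha hb x hx => by rw [mul_smul]; exact ha _ (hb _ hx)
      one_mem' := fun x hx => by simpa using hx
      add_mem' := fun {a b} ha hb x hx => by rw [add_smul]; exact add_mem (ha _ hx) (hb _ hx)
      zero_mem' := fun x hx => by simp
      neg_mem' := fun {a} ha x hx => by rw [neg_smul]; exact neg_mem (ha _ hx) }
  have hS : S = ⊤ := by
    refine hgen S ?_ ?_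
    · intro x hx
      obtain ⟨y, hy, z, hz, rfl⟩ := AddSubgroup.mem_sup.1 hx
      rw [smul_add]
      refine add_mem ?_ (AddSubgroup.mem_sup_right ?_)
      · refine AddSubgroup.closure_induction (p := fun y _ => t • y ∈ J ⊔ D) ?_ ?_ ?_ ?_ hy
        · rintro _ ⟨j, rfl⟩
          obtain ⟨g, hg⟩ := h1 (Pi.single j 1)
          have : t • F (Pi.single j 1) = F ((M.map (Nat.cast : ℕ → R)).mulVec (Pi.single j 1))
              - (p : R) • g := by
            rw [← hg]; simp
          simp only
          rw [this]
          refine sub_mem (AddSubgroup.mem_sup_left ?_) (AddSubgroup.mem_sup_right (hD g))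
          have : (M.map (Nat.cast : ℕ → R)).mulVec (Pi.single j 1) =
              ∑ i, M i j • (Pi.single i 1 : Fin n → R) := by
            ext k
            simp [Finset.sum_apply, Pi.single_apply]
          rw [this, map_sum]
          refine sum_mem fun i _ => ?_
          rw [map_nsmul]
          exact nsmul_mem (hJm i) _
        · simp
        · intro x y _ _ hx hy
          rw [smul_add]; exact add_mem hx hy
        · intro x _ hx
          rw [smul_neg]; exact neg_mem hx
      · obtain ⟨g, rfl⟩ := hz
        exact ⟨t • g, smul_comm _ _ _⟩
    · intro a x hx
      rw [mul_smul]
      exact AddSubgroup.mem_sup_right (hD _)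
  have hSm : ∀ (a : R), ∀ x ∈ J ⊔ D, a • x ∈ J ⊔ D := by
    intro a
    have : a ∈ S := by rw [hS]; trivial
    exact this
  have hF : ∀ x, F x ∈ J ⊔ D := by
    intro x
    have : x = ∑ i, x i • (Pi.single i 1 : Fin n → R) := by
      ext k
      simp [Finset.sum_apply, Pi.single_apply]
    rw [this, map_sum]
    refine sum_mem fun i _ => ?_
    rw [map_smul]
    exact hSm _ _ (AddSubgroup.mem_sup_left (hJm i))
  have hG1 : ∀ g, ∃ j ∈ J, ∃ g', g = j + (p : R) • g' := by
    intro g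
    have : g ∈ J ⊔ D := by
      obtain ⟨x, g', rfl⟩ := h2 g
      exact add_mem (hF x) (AddSubgroup.mem_sup_right (hD _))
    obtain ⟨y, hy, _, ⟨z, rfl⟩, rfl⟩ := AddSubgroup.mem_sup.1 this
    exact ⟨y, hy, z, rfl⟩
  have hGk : ∀ k : ℕ, ∀ g, ∃ j ∈ J, ∃ g', g = j + (p : R) ^ k • g' := by
    intro k
    induction k with
    | zero => exact fun g => ⟨0, zero_mem _, g, by simp⟩
    | succ k ih =>
      intro g
      obtain ⟨j, hj, g', rfl⟩ := ih g
      obtain ⟨j', hj', g'', rfl⟩ := hG1 g'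
      refine ⟨j + p ^ k • j', add_mem hj (nsmul_mem hj' _), g'', ?_⟩
      rw [smul_add, ← add_assoc, pow_succ, mul_smul]
      congr 2
      rw [← Nat.cast_smul_eq_nsmul R, Nat.cast_pow]
  rw [eq_top_iff]
  rintro g -
  obtain ⟨j, hj, g', rfl⟩ := hGk N g
  rw [hN, add_zero]
  exact hj

theorem aux_mod_smul {R G : Type*} [CommRing R] [AddCommGroup G] [Module R G] (p N : ℕ)
    (hN : ∀ x : G, (p : R) ^ N • x = 0) (a b : ℕ) (h : a ≡ b [MOD p ^ N]) (g : G) :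
    (a : R) • g = (b : R) • g := by
  have key : ∀ a : ℕ, (a : R) • g = ((a % p ^ N : ℕ) : R) • g := by
    intro a
    conv_lhs => rw [← Nat.mod_add_div a (p ^ N)]
    rw [Nat.cast_add, Nat.cast_mul, add_smul, mul_smul, Nat.cast_pow, hN, add_zero]
  rw [key a, key b, h]

/-- the linear map of the canonical lift of a matrix over `ℤ/p^N`. -/
noncomputable def auxLift (R : Type*) [CommRing R] {n m : ℕ}
    (Y : Matrix (Fin n) (Fin n) (ZMod m)) : (Fin n → R) →ₗ[R] (Fin n → R) :=
  (Y.map (fun y => ((y.val : ℕ) : R))).mulVecLin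

theorem auxLift_single (R : Type*) [CommRing R] {n m : ℕ}
    (Y : Matrix (Fin n) (Fin n) (ZMod m)) (j : Fin n) :
    auxLift R Y (Pi.single j 1) = ∑ i, ((Y i j).val : R) • (Pi.single i 1 : Fin n → R) := by
  ext k
  simp [auxLift, Finset.sum_apply, Pi.single_apply]

theorem aux_countY {R G : Type} [CommRing R] [AddCommGroup G] [Module R G] [Finite G]
    {n : ℕ} (p : ℕ) [Fact p.Prime] (t : R)
    (hgen : ∀ S : Subring R, t ∈ S → (∀ a, (p : R) * a ∈ S) → S = ⊤)
    (N : ℕ) (hN : ∀ x : G, (p : R) ^ N • x = 0)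
    (M : Matrix (Fin n) (Fin n) ℕ)
    (F : (Fin n → R) →ₗ[R] G)
    (h1 : ∀ x, ∃ g, F (((M.map (Nat.cast : ℕ → R)).mulVecLin - t • LinearMap.id :
      (Fin n → R) →ₗ[R] (Fin n → R)) x) = (p : R) • g)
    (h2 : ∀ g, ∃ x g', g = F x + (p : R) • g') (Q : ((Fin n → R) →ₗ[R] G) → Prop) :
    Nat.card {Y : Matrix (Fin n) (Fin n) (ZMod (p ^ N)) // Q (F.comp (auxLift R Y))} *
      Nat.card G ^ n = Nat.card {Φ // Q Φ} * p ^ (N * n ^ 2) := by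
  haveI : NeZero (p ^ N) := ⟨pow_ne_zero _ (Fact.out : p.Prime).ne_zero⟩
  have hJ := aux_J p t hgen N hN M F h1 h2
  let e : Matrix (Fin n) (Fin n) (ZMod (p ^ N)) →+ ((Fin n → R) →ₗ[R] G) :=
    AddMonoidHom.mk' (fun Y => F.comp (auxLift R Y)) (by
      intro Y Y'
      refine LinearMap.pi_ext' fun j => LinearMap.ext_ring ?_
      simp only [LinearMap.comp_apply, LinearMap.add_apply, LinearMap.single_apply,
        auxLift_single, map_sum, map_smul, ← Finset.sum_add_distrib, ← add_smul, ← Nat.cast_add]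
      refine Finset.sum_congr rfl fun i _ => aux_mod_smul p N hN _ _ ?_ _
      rw [Matrix.add_apply, ZMod.val_add]
      exact Nat.mod_modEq _ _)
  have he : Function.Surjective e := by
    intro Φ
    have : ∀ j, ∃ y : Fin n → ZMod (p ^ N), ∑ i, ((y i).val : R) • F (Pi.single i 1) =
        Φ (Pi.single j 1) := by
      intro j
      have hm : Φ (Pi.single j 1) ∈ AddSubgroup.closure
          (Set.range fun i => F (Pi.single i 1)) := by rw [hJ]; trivial
      refine AddSubgroup.closure_induction (p := fun g _ => ∃ y : Fin n → ZMod (p ^ N),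
        ∑ i, ((y i).val : R) • F (Pi.single i 1) = g) ?_ ?_ ?_ ?_ hm
      · rintro _ ⟨i, rfl⟩
        refine ⟨Pi.single i 1, ?_⟩
        rw [Finset.sum_eq_single i]
        · rw [Pi.single_eq_same]
          have := aux_mod_smul p N hN (ZMod.val (1 : ZMod (p ^ N))) 1 (by
            rw [ZMod.val_one_eq_one_mod]; exact Nat.mod_modEq _ _) (F (Pi.single i 1))
          rw [this, Nat.cast_one, one_smul]
        · intro k _ hk
          rw [Pi.single_eq_of_ne hk]; simp
        · simp
      · exact ⟨0, by simp⟩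
      · rintro _ _ _ _ ⟨y, rfl⟩ ⟨y', rfl⟩
        refine ⟨y + y', ?_⟩
        simp only [← Finset.sum_add_distrib, ← add_smul, ← Nat.cast_add]
        refine Finset.sum_congr rfl fun i _ => aux_mod_smul p N hN _ _ ?_ _
        rw [Pi.add_apply, ZMod.val_add]
        exact Nat.mod_modEq _ _
      · rintro _ _ ⟨y, rfl⟩
        refine ⟨-y, ?_⟩
        rw [eq_neg_iff_add_eq_zero]
        simp only [← Finset.sum_add_distrib, ← add_smul, ← Nat.cast_add]
        refine Finset.sum_eq_zero fun i _ => ?_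
        rw [← zero_smul R (F (Pi.single i 1)), ← Nat.cast_zero (R := R)]
        rw [aux_mod_smul p N hN ((-y) i + y i).val 0 (by simp [Nat.ModEq]) (F (Pi.single i 1)) |>.symm]
        refine aux_mod_smul p N hN _ _ ?_ _
        rw [ZMod.val_add]
        exact (Nat.mod_modEq _ _).symm
    choose y hy using this
    refine ⟨Matrix.of fun i j => y j i, ?_⟩
    refine LinearMap.pi_ext' fun j => LinearMap.ext_ring ?_
    simp only [e, AddMonoidHom.mk'_apply, LinearMap.comp_apply, LinearMap.single_apply,
        auxLift_single, map_sum, map_smul]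
    exact hy j
  have h := aux_fiber_count' e he Q
  have hG : Nat.card ((Fin n → R) →ₗ[R] G) = Nat.card G ^ n := by
    rw [← Nat.card_congr ((Pi.basisFun R (Fin n)).constr ℕ (M' := G)).toEquiv]
    rw [Nat.card_fun, Nat.card_fin]
  have hM : Nat.card (Matrix (Fin n) (Fin n) (ZMod (p ^ N))) = p ^ (N * n ^ 2) := by
    rw [Matrix, Nat.card_fun, Nat.card_fun, Nat.card_fin, Nat.card_zmod]
    ring
  rw [hG, hM] at h
  exact h

theorem aux_total {R G : Type} [CommRing R] [IsDomain R] [IsLocalRing R] [IsNoetherianRing R]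
    [AddCommGroup G] [Module R G] [Finite G]
    {n : ℕ} (p : ℕ) [Fact p.Prime] (hp0 : (p : R) ≠ 0) [hmax : (Ideal.span {(p : R)}).IsMaximal]
    (t : R)
    (hgen : ∀ S : Subring R, t ∈ S → (∀ a, (p : R) * a ∈ S) → S = ⊤)
    (N : ℕ) (hN : ∀ x : G, (p : R) ^ N • x = 0)
    (M : Matrix (Fin n) (Fin n) ℕ) {q r : ℕ} (hq1 : 1 < q)
    (hq : Nat.card (R ⧸ Ideal.span {(p : R)}) = q)
    (hG : Nat.card (G ⧸ LinearMap.range (LinearMap.lsmul R G (p : R))) = q ^ r)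
    (A : (Fin n → R) →ₗ[R] (Fin n → R))
    (hAdef : A = (M.map (Nat.cast : ℕ → R)).mulVecLin - t • LinearMap.id)
    (hA : Nat.card ((Fin n → R) ⧸
      (LinearMap.range A ⊔ LinearMap.range (LinearMap.lsmul R (Fin n → R) (p : R)))) = q ^ r) :
    Nat.card {Y : Matrix (Fin n) (Fin n) (ZMod (p ^ N)) //
      Nonempty (((Fin n → R) ⧸ (LinearMap.range (A + (p : R) • auxLift R Y) ⊔
        LinearMap.range (LinearMap.lsmul R (Fin n → R) ((p : R) ^ (N + 1))))) ≃ₗ[R] G)} *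
      Nat.card (G ≃ₗ[R] G) * (q ^ r) ^ r =
    (∏ i : Fin r, (q ^ r - q ^ (i : ℕ))) ^ 2 * p ^ (N * n ^ 2) := by
  have hpu : ¬ IsUnit (p : R) := by
    intro h
    exact hmax.ne_top (Ideal.span_singleton_eq_top.2 h)
  haveI : NeZero (p ^ N) := ⟨pow_ne_zero _ (Fact.out : p.Prime).ne_zero⟩
  haveI : Finite ((Fin n → R) →ₗ[R] G) :=
    Finite.of_equiv _ ((Pi.basisFun R (Fin n)).constr ℕ (M' := G)).toEquiv
  haveI : Finite (R ⧸ Ideal.span {(p : R)}) := Nat.finite_of_card_ne_zero (by omega)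
  rw [← aux_autcount]
  set L := LinearMap.range (LinearMap.lsmul R (Fin n → R) (p : R)) with hL
  haveI hLf : Finite ((Fin n → R) ⧸ L) := aux_finite_quot (p : R) n
  set Vd : ((Fin n → R) →ₗ[R] G) → Prop := fun F => (∀ x, ∃ g, F (A x) = (p : R) • g) ∧
      ∀ g, ∃ x g', g = F x + (p : R) • g' with hVd
  set Q : ((Fin n → R) →ₗ[R] G) → ((Fin n → R) →ₗ[R] G) → Prop := fun F Φ =>
    (∀ x, F (A x) + (p : R) • Φ x = 0) ∧
      ∀ g, (p : R) • g = 0 → ∃ w h, A w = (p : R) • h ∧ F h + Φ w = g with hQ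
  have hsup : ∀ Y : Matrix (Fin n) (Fin n) (ZMod (p ^ N)),
      LinearMap.range (A + (p : R) • auxLift R Y) ⊔ L = LinearMap.range A ⊔ L := by
    intro Y
    refine le_antisymm (sup_le ?_ le_sup_right) (sup_le ?_ le_sup_right)
    · rintro _ ⟨x, rfl⟩
      exact Submodule.add_mem_sup ⟨x, rfl⟩ ⟨auxLift R Y x, rfl⟩
    · rintro _ ⟨x, rfl⟩
      have : A x = (A + (p : R) • auxLift R Y) x + (p : R) • (- auxLift R Y x) := by simp
      rw [this]
      exact Submodule.add_mem_sup ⟨x, rfl⟩ ⟨_, rfl⟩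
  have hiff : ∀ (Y : Matrix (Fin n) (Fin n) (ZMod (p ^ N))) (F : (Fin n → R) →ₗ[R] G),
      (Function.Surjective F ∧ LinearMap.ker F = LinearMap.range (A + (p : R) • auxLift R Y) ⊔
        LinearMap.range (LinearMap.lsmul R (Fin n → R) ((p : R) ^ (N + 1)))) ↔
      (Vd F ∧ Q F (F.comp (auxLift R Y))) := by
    intro Y F
    haveI : Finite ((Fin n → R) ⧸ (LinearMap.range (A + (p : R) • auxLift R Y) ⊔ L)) := by
      rw [hsup]; exact Nat.finite_of_card_ne_zero (by rw [hA]; positivity)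
    rw [aux_claimII hpu N hN (A + (p : R) • auxLift R Y) F (by rw [hsup, hA, hG])]
    have e1 : ∀ x, F ((A + (p : R) • auxLift R Y) x) =
        F (A x) + (p : R) • (F.comp (auxLift R Y)) x := by
      intro x; simp
    constructor
    · rintro ⟨h1, h2, h3⟩
      refine ⟨⟨fun x => ⟨- F (auxLift R Y x), ?_⟩, h2⟩, fun x => by rw [← e1, h1], ?_⟩
      · have := h1 x
        rw [e1] at this
        rw [smul_neg]
        exact eq_neg_of_add_eq_zero_left this
      · intro g hg
        obtain ⟨w, h, hw, hh⟩ := h3 g hg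
        refine ⟨w, h - auxLift R Y w, ?_, ?_⟩
        · rw [smul_sub, ← hw]; simp
        · simp [hh]
    · rintro ⟨⟨-, h2⟩, h1, h3⟩
      refine ⟨fun x => by rw [e1, h1], h2, ?_⟩
      intro g hg
      obtain ⟨w, h, hw, hh⟩ := h3 g hg
      refine ⟨w, h + auxLift R Y w, ?_, ?_⟩
      · simp [hw]
      · simpa using hh
  have hequiv : Nat.card {x : Matrix (Fin n) (Fin n) (ZMod (p ^ N)) × ((Fin n → R) →ₗ[R] G) //
        Function.Surjective x.2 ∧ LinearMap.ker x.2 =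
          LinearMap.range (A + (p : R) • auxLift R x.1) ⊔
          LinearMap.range (LinearMap.lsmul R (Fin n → R) ((p : R) ^ (N + 1)))} =
      Nat.card (Σ F : {F // Vd F}, {Y : Matrix (Fin n) (Fin n) (ZMod (p ^ N)) //
        Q F.1 (F.1.comp (auxLift R Y))}) := by
    refine Nat.card_congr
      { toFun := fun x => ⟨⟨x.1.2, ((hiff _ _).1 x.2).1⟩, ⟨x.1.1, ((hiff _ _).1 x.2).2⟩⟩
        invFun := fun x => ⟨(x.2.1, x.1.1), (hiff _ _).2 ⟨x.1.2, x.2.2⟩⟩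
        left_inv := fun x => rfl
        right_inv := fun x => rfl }
  rw [hequiv]
  -- kernel of `A` mod `p`
  have hle : L ≤ L.comap A := by
    rintro _ ⟨x, rfl⟩
    exact ⟨A x, by simp⟩
  set V := LinearMap.ker (L.mapQ L A hle) with hV
  have hVc : Nat.card V = q ^ r := by
    rw [aux_card_ker, ← hA]
    have : LinearMap.range (L.mapQ L A hle) = (LinearMap.range A).map L.mkQ := by
      rw [← LinearMap.range_comp, ← Submodule.mapQ_mkQ L L A (h := hle), LinearMap.range_comp,
        Submodule.range_mkQ, Submodule.map_top]
    rw [this, sup_comm]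
    exact Nat.card_congr (Submodule.quotientQuotientEquivQuotientSup L (LinearMap.range A)).toEquiv
  have hVA : ∀ x, Submodule.Quotient.mk x ∈ V ↔ ∃ y, A x = (p : R) • y := by
    intro x
    rw [hV, LinearMap.mem_ker, Submodule.mapQ_apply, Submodule.Quotient.mk_eq_zero]
    simp [hL, eq_comm]
  have hGk : Nat.card (LinearMap.ker (LinearMap.lsmul R G (p : R))) = q ^ r := by
    rw [aux_card_ker, hG]
  set S := ∏ i : Fin r, (q ^ r - q ^ (i : ℕ)) with hS
  have hinner : ∀ F : {F // Vd F}, Nat.card {Y : Matrix (Fin n) (Fin n) (ZMod (p ^ N)) //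
        Q F.1 (F.1.comp (auxLift R Y))} * (Nat.card G ^ n * (q ^ r) ^ r) =
        S * (q ^ r) ^ n * p ^ (N * n ^ 2) := by
    rintro ⟨F, h1, h2⟩
    have ha := aux_countY p t hgen N hN M F (by rw [← hAdef]; exact h1) h2 (Q F)
    choose g hg using fun i => h1 (Pi.single i 1)
    let Φ0 : (Fin n → R) →ₗ[R] G := (Pi.basisFun R (Fin n)).constr ℕ (fun i => - g i)
    have hΦ0 : ∀ x, F (A x) + (p : R) • Φ0 x = 0 := by
      intro x
      have : F.comp A + (p : R) • Φ0 = 0 := by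
        refine LinearMap.pi_ext' fun j => LinearMap.ext_ring ?_
        have : Φ0 (Pi.single j 1) = - g j := by
          simp [Φ0]
        simp [this, hg]
      exact LinearMap.congr_fun this x
    have hb := aux_countPsi hp0 hq1 hq A F hGk V hVc hVA Φ0 hΦ0
    calc _ = (Nat.card {Y : Matrix (Fin n) (Fin n) (ZMod (p ^ N)) //
        Q F (F.comp (auxLift R Y))} * Nat.card G ^ n) * (q ^ r) ^ r := by ring
      _ = (Nat.card {Φ // Q F Φ} * (q ^ r) ^ r) * p ^ (N * n ^ 2) := by rw [ha]; ring
      _ = _ := by rw [hb]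
  have hc := aux_countF (G := G) hq1 hq A hG hA
  have hGc : Nat.card G = q ^ r * Nat.card (LinearMap.range (LinearMap.lsmul R G (p : R))) := by
    rw [Submodule.card_eq_card_quotient_mul_card (LinearMap.range (LinearMap.lsmul R G (p : R))), hG]
    ring
  have hGpos : 0 < Nat.card G := Nat.card_pos
  letI := Fintype.ofFinite {F // Vd F}
  rw [Nat.card_sigma]
  have hqp : 0 < q ^ r := by positivity
  refine Nat.eq_of_mul_eq_mul_right (pow_pos hGpos n) ?_
  rw [mul_assoc, mul_comm ((q ^ r) ^ r), Finset.sum_mul, Finset.sum_congr rfl (fun F _ => hinner F),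
    Finset.sum_const, Finset.card_univ, ← Nat.card_eq_fintype_card, hc, hGc]
  simp only [smul_eq_mul]
  ring

theorem aux_card_torsion {R : Type*} [CommRing R] [IsDomain R] [IsPrincipalIdealRing R]
    {π : R} (hπ : Prime π) {q : ℕ} (hq1 : 1 < q) (hq : Nat.card (R ⧸ Ideal.span {π}) = q)
    (k j : ℕ) :
    Nat.card {x : R ⧸ Ideal.span {π ^ k} // π ^ j • x = 0} = q ^ (min j k) := by
  have hpow : ∀ k, Nat.card (R ⧸ Ideal.span {π ^ k}) = q ^ k := by
    intro k
    haveI : (Ideal.span {π}).IsPrime := (Ideal.span_singleton_prime hπ.ne_zero).2 hπ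
    have := cardQuot_pow_of_prime (P := Ideal.span {π}) (i := k)
      (by simpa using hπ.ne_zero)
    rw [Ideal.span_singleton_pow] at this
    rw [← hq]
    exact this
  haveI : Finite (R ⧸ Ideal.span {π ^ k}) :=
    Nat.finite_of_card_ne_zero (by rw [hpow]; positivity)
  have h1 : Nat.card {x : R ⧸ Ideal.span {π ^ k} // π ^ j • x = 0} =
      Nat.card (LinearMap.ker (LinearMap.lsmul R (R ⧸ Ideal.span {π ^ k}) (π ^ j))) :=
    Nat.card_congr (Equiv.subtypeEquivRight fun x => by simp)
  rw [h1, aux_card_ker]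
  have h2 : LinearMap.range (LinearMap.lsmul R (R ⧸ Ideal.span {π ^ k}) (π ^ j)) =
      Submodule.map (Submodule.mkQ (Ideal.span {π ^ k})) (Ideal.span {π ^ j}) := by
    ext x
    constructor
    · rintro ⟨y, rfl⟩
      obtain ⟨y, rfl⟩ := Submodule.Quotient.mk_surjective _ y
      exact ⟨π ^ j * y, Ideal.mul_mem_right _ _ (Ideal.mem_span_singleton_self _), rfl⟩
    · rintro ⟨y, hy, rfl⟩
      obtain ⟨a, rfl⟩ := Ideal.mem_span_singleton'.1 hy
      exact ⟨Submodule.Quotient.mk a, by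
        show Submodule.Quotient.mk (π ^ j * a) = Submodule.Quotient.mk (a * π ^ j)
        rw [mul_comm]⟩
  rw [h2, Nat.card_congr (Submodule.quotientQuotientEquivQuotientSup (Ideal.span {π ^ k})
    (Ideal.span {π ^ j})).toEquiv]
  rcases le_total j k with h | h
  · rw [min_eq_left h, sup_eq_right.2, hpow]
    exact Ideal.span_singleton_le_span_singleton.2 (pow_dvd_pow _ h)
  · rw [min_eq_right h, sup_eq_left.2, hpow]
    exact Ideal.span_singleton_le_span_singleton.2 (pow_dvd_pow _ h)

theorem aux_struct {R : Type*} [CommRing R] [IsDomain R] [IsPrincipalIdealRing R]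
    {π : R} (hπ : Prime π) {q : ℕ} (hq1 : 1 < q) (hq : Nat.card (R ⧸ Ideal.span {π}) = q)
    (G : Type*) [AddCommGroup G] [Module R G] [Finite G] (m : ℕ) (hm : ∀ x : G, π ^ m • x = 0) :
    ∃ (d : ℕ) (k : Fin d → ℕ),
      Nonempty (G ≃ₗ[R] (∀ i : {i // 0 < k i}, R ⧸ Ideal.span {π ^ (k i.1)})) ∧
      ∀ j, Nat.card {x : G // π ^ j • x = 0} = q ^ (∑ i, min j (k i)) := by
  obtain ⟨d, k, ⟨e⟩⟩ := Module.torsion_by_prime_power_decomposition (M := G) hπ.irreducible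
    (fun {x} => ⟨⟨π ^ m, m, rfl⟩, hm x⟩)
  let e' : G ≃ₗ[R] (∀ i : Fin d, R ⧸ Ideal.span {π ^ (k i)}) :=
    e.trans (DirectSum.linearEquivFunOnFintype R (Fin d) _)
  have hg : Function.Bijective (LinearMap.pi (fun i => LinearMap.proj i.1) :
      (∀ i : Fin d, R ⧸ Ideal.span {π ^ (k i)}) →ₗ[R]
        (∀ i : {i // 0 < k i}, R ⧸ Ideal.span {π ^ (k i.1)})) := by
    refine ⟨?_, ?_⟩
    · intro x y hxy
      ext i
      by_cases hi : 0 < k i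
      · exact congrFun hxy ⟨i, hi⟩
      · have : k i = 0 := by omega
        have : Ideal.span {π ^ (k i)} = ⊤ := by rw [this]; simp
        have : Subsingleton (R ⧸ Ideal.span {π ^ (k i)}) :=
          Ideal.Quotient.subsingleton_iff.2 this
        exact Subsingleton.elim _ _
    · intro y
      refine ⟨fun i => if hi : 0 < k i then y ⟨i, hi⟩ else 0, ?_⟩
      ext i
      simp [i.2]
  refine ⟨d, k, ⟨e'.trans (LinearEquiv.ofBijective _ hg)⟩, ?_⟩
  · intro j
    have : Nat.card {x : G // π ^ j • x = 0} =
        Nat.card (∀ i : Fin d, {x : R ⧸ Ideal.span {π ^ (k i)} // π ^ j • x = 0}) := by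
      refine Nat.card_congr (Equiv.trans ?_ (Equiv.subtypePiEquivPi
        (p := fun {i} (x : R ⧸ Ideal.span {π ^ (k i)}) => π ^ j • x = 0)))
      refine e'.toEquiv.subtypeEquiv fun x => ?_
      rw [← e'.map_eq_zero_iff, map_smul, funext_iff]
      rfl
    rw [this, Nat.card_pi, Finset.prod_congr rfl fun i _ =>
      aux_card_torsion hπ hq1 hq (k i) j, Finset.prod_pow_eq_pow_sum]

theorem aux_comb {d d' : ℕ} (k : Fin d → ℕ) (l : Fin d' → ℕ)
    (h : ∀ j, ∑ i, min j (k i) = ∑ i, min j (l i)) :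
    ∃ σ : {i // 0 < k i} ≃ {i // 0 < l i}, ∀ i, l (σ i).1 = k i.1 := by
  have h1 : ∀ (d : ℕ) (k : Fin d → ℕ) (j : ℕ), ∑ i, min (j + 1) (k i) = ∑ i, min j (k i) +
      Fintype.card {i // j < k i} := by
    intro d k j
    rw [Fintype.card_subtype, Finset.card_filter, ← Finset.sum_add_distrib]
    refine Finset.sum_congr rfl fun i _ => ?_
    split_ifs <;> omega
  have h2 : ∀ j, Fintype.card {i // j < k i} = Fintype.card {i // j < l i} := by
    intro j
    have := h (j + 1)
    rw [h1, h1, h j] at this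
    omega
  have h3 : ∀ (d : ℕ) (k : Fin d → ℕ) (j : ℕ), Fintype.card {i // j < k i} =
      Fintype.card {i // k i = j + 1} + Fintype.card {i // j + 1 < k i} := by
    intro d k j
    simp only [Fintype.card_subtype, Finset.card_filter, ← Finset.sum_add_distrib]
    refine Finset.sum_congr rfl fun i _ => ?_
    split_ifs <;> omega
  have h4 : ∀ j, Fintype.card {i // k i = j + 1} = Fintype.card {i // l i = j + 1} := by
    intro j
    have a := h3 d k j
    have b := h3 d' l j
    rw [h2, h2 (j + 1)] at a
    omega
  have h5 : ∀ j, Nonempty ({i : {i // 0 < k i} // k i.1 = j} ≃ {i : {i // 0 < l i} // l i.1 = j}) := by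
    intro j
    cases j with
    | zero =>
      haveI : IsEmpty {i : {i // 0 < k i} // k i.1 = 0} := ⟨fun i => by have := i.1.2; have := i.2; omega⟩
      haveI : IsEmpty {i : {i // 0 < l i} // l i.1 = 0} := ⟨fun i => by have := i.1.2; have := i.2; omega⟩
      exact ⟨Equiv.equivOfIsEmpty _ _⟩
    | succ j =>
      have f : ∀ (d : ℕ) (k : Fin d → ℕ),
          {i : {i // 0 < k i} // k i.1 = j + 1} ≃ {i // k i = j + 1} := fun d k =>
        Equiv.subtypeSubtypeEquivSubtype (p := fun i => 0 < k i) (q := fun i => k i = j + 1)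
          (fun {x} hx => by omega)
      exact ⟨(f d k).trans ((Fintype.equivOfCardEq (h4 j)).trans (f d' l).symm)⟩
  refine ⟨((Equiv.sigmaFiberEquiv (fun i : {i // 0 < k i} => k i.1)).symm.trans
    (Equiv.sigmaCongrRight fun j => (h5 j).some)).trans (Equiv.sigmaFiberEquiv _), fun i => ?_⟩
  exact ((h5 (k i.1)).some ⟨i, rfl⟩).2

theorem aux_classify {R : Type*} [CommRing R] [IsDomain R] [IsPrincipalIdealRing R]
    {p : ℕ} (hπ : Prime (p : R)) {q : ℕ} (hq1 : 1 < q)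
    (hq : Nat.card (R ⧸ Ideal.span {(p : R)}) = q)
    (G H : Type*) [AddCommGroup G] [Module R G] [Finite G] [AddCommGroup H] [Module R H]
    (m : ℕ) (hm : ∀ x : G, (p : R) ^ m • x = 0) (f : H ≃+ G) : Nonempty (H ≃ₗ[R] G) := by
  haveI : Finite H := Finite.of_equiv _ f.toEquiv.symm
  have hs : ∀ j (x : H), f ((p : R) ^ j • x) = (p : R) ^ j • f x := by
    intro j x
    rw [← Nat.cast_pow, Nat.cast_smul_eq_nsmul, Nat.cast_smul_eq_nsmul, map_nsmul]
  have hm' : ∀ x : H, (p : R) ^ m • x = 0 := by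
    intro x
    apply f.injective
    rw [hs, hm, map_zero]
  obtain ⟨d, k, ⟨e⟩, hk⟩ := aux_struct hπ hq1 hq H m hm'
  obtain ⟨d', l, ⟨e'⟩, hl⟩ := aux_struct hπ hq1 hq G m hm
  obtain ⟨σ, hσ⟩ := aux_comb k l (by
    intro j
    apply Nat.pow_right_injective hq1
    show q ^ _ = q ^ _
    rw [← hk, ← hl]
    refine Nat.card_congr (f.toEquiv.subtypeEquiv fun x => ?_)
    rw [← f.map_eq_zero_iff, hs]; rfl)
  let g1 : (∀ i : {i // 0 < k i}, R ⧸ Ideal.span {(p : R) ^ (k i.1)}) ≃ₗ[R]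
      (∀ i : {i // 0 < k i}, R ⧸ Ideal.span {(p : R) ^ (l (σ i).1)}) :=
    LinearEquiv.piCongrRight fun i => Submodule.quotEquivOfEq _ _ (by rw [hσ])
  let g2 : (∀ i : {i // 0 < k i}, R ⧸ Ideal.span {(p : R) ^ (l (σ i).1)}) ≃ₗ[R]
      (∀ i : {i // 0 < l i}, R ⧸ Ideal.span {(p : R) ^ (l i.1)}) :=
    LinearEquiv.piCongrLeft R
      (fun i : {i // 0 < l i} => R ⧸ Ideal.span {(p : R) ^ (l i.1)}) σ
  exact ⟨e.trans (g1.trans (g2.trans e'.symm))⟩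

theorem aux_R1 (p : ℕ) [Fact p.Prime] (P : Polynomial ℤ_[p]) (hP : P.Monic)
    (hirr : Irreducible (P.map (PadicInt.toZMod : ℤ_[p] →+* ZMod p))) :
    IsDomain (AdjoinRoot P) ∧ IsNoetherianRing (AdjoinRoot P) ∧ (p : AdjoinRoot P) ≠ 0 := by
  have h1 : Irreducible P := hP.irreducible_of_irreducible_map _ _ hirr
  have h2 : Prime P := h1.prime
  haveI : IsDomain (AdjoinRoot P) := AdjoinRoot.isDomain_of_prime h2
  haveI : Module.Finite ℤ_[p] (AdjoinRoot P) := hP.finite_adjoinRoot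
  refine ⟨inferInstance, ?_, ?_⟩
  · exact IsNoetherianRing.of_finite ℤ_[p] (AdjoinRoot P)
  · intro h
    have h3 : AdjoinRoot.mk P (Polynomial.C (p : ℤ_[p])) = 0 := by simpa using h
    rw [AdjoinRoot.mk_eq_zero] at h3
    have hd : 0 < P.natDegree := by
      have := hirr.natDegree_pos
      rwa [hP.natDegree_map] at this
    have h4 := Polynomial.natDegree_le_of_dvd h3 (by
      simpa using (Nat.Prime.ne_zero (Fact.out : p.Prime)))
    rw [Polynomial.natDegree_C] at h4
    omega

theorem aux_R2 (p : ℕ) [Fact p.Prime] (P : Polynomial ℤ_[p]) (hP : P.Monic)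
    (hirr : Irreducible (P.map (PadicInt.toZMod : ℤ_[p] →+* ZMod p))) :
    (Ideal.span {(p : AdjoinRoot P)}).IsMaximal ∧
    Nat.card (AdjoinRoot P ⧸ Ideal.span {(p : AdjoinRoot P)}) = p ^ P.natDegree := by
  let f : ℤ_[p] →+* ZMod p := PadicInt.toZMod
  haveI : Fact (Irreducible (P.map f)) := ⟨hirr⟩
  let φ : AdjoinRoot P →+* AdjoinRoot (P.map f) := AdjoinRoot.map f P (P.map f) dvd_rfl
  have hf : Function.Surjective f := ZMod.ringHom_surjective f
  have hφ : ∀ g, φ (AdjoinRoot.mk P g) = AdjoinRoot.mk (P.map f) (g.map f) := by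
    intro g
    induction g using Polynomial.induction_on' with
    | add a b ha hb => simp [ha, hb]
    | monomial n a => simp [φ, AdjoinRoot.map, ← Polynomial.C_mul_X_pow_eq_monomial]
  have hs : Function.Surjective φ := by
    intro y
    obtain ⟨y, rfl⟩ := AdjoinRoot.mk_surjective y
    obtain ⟨g, rfl⟩ := Polynomial.map_surjective f hf y
    exact ⟨_, hφ g⟩
  have hk : RingHom.ker φ = Ideal.span {(p : AdjoinRoot P)} := by
    apply le_antisymm
    · intro x hx
      obtain ⟨g, rfl⟩ := AdjoinRoot.mk_surjective x
      rw [RingHom.mem_ker, hφ, AdjoinRoot.mk_eq_zero] at hx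
      obtain ⟨h, hh⟩ := hx
      obtain ⟨h, rfl⟩ := Polynomial.map_surjective f hf h
      have h5 : (g - P * h).map f = 0 := by simp [hh]
      have h6 : Polynomial.C (p : ℤ_[p]) ∣ g - P * h := by
        rw [Polynomial.C_dvd_iff_dvd_coeff]
        intro i
        have : f ((g - P * h).coeff i) = 0 := by rw [← Polynomial.coeff_map, h5]; simp
        rwa [← RingHom.mem_ker, PadicInt.ker_toZMod, PadicInt.maximalIdeal_eq_span_p,
          Ideal.mem_span_singleton] at this
      obtain ⟨w, hw⟩ := h6
      rw [Ideal.mem_span_singleton]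
      refine ⟨AdjoinRoot.mk P w, ?_⟩
      have := congrArg (AdjoinRoot.mk P) hw
      simpa using this
    · rw [Ideal.span_singleton_le_iff_mem, RingHom.mem_ker, map_natCast]
      rw [← map_natCast (algebraMap (ZMod p) (AdjoinRoot (P.map f))), ZMod.natCast_self, map_zero]
  rw [← hk]
  refine ⟨RingHom.ker_isMaximal_of_surjective φ hs, ?_⟩
  rw [Nat.card_congr (RingHom.quotientKerEquivOfSurjective hs).toEquiv]
  have hm : (P.map f).Monic := hP.map f
  let b := AdjoinRoot.powerBasis' hm
  rw [Nat.card_congr b.basis.equivFun.toEquiv, Nat.card_fun]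
  simp [b, hP.natDegree_map]

theorem aux_R3 (p : ℕ) [Fact p.Prime] (P : Polynomial ℤ_[p]) (hP : P.Monic)
    (hirr : Irreducible (P.map (PadicInt.toZMod : ℤ_[p] →+* ZMod p))) :
    IsLocalRing (AdjoinRoot P) ∧ IsPrincipalIdealRing (AdjoinRoot P) ∧
      Prime (p : AdjoinRoot P) := by
  obtain ⟨_, _, hp0⟩ := aux_R1 p P hP hirr
  obtain ⟨hmax, -⟩ := aux_R2 p P hP hirr
  haveI : Module.Finite ℤ_[p] (AdjoinRoot P) := hP.finite_adjoinRoot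
  haveI : Algebra.IsIntegral ℤ_[p] (AdjoinRoot P) := inferInstance
  have hu : ∀ I : Ideal (AdjoinRoot P), I.IsMaximal → I = Ideal.span {(p : AdjoinRoot P)} := by
    intro I hI
    have h1 : (I.comap (algebraMap ℤ_[p] (AdjoinRoot P))).IsMaximal :=
      Ideal.isMaximal_comap_of_isIntegral_of_isMaximal I
    have h2 := IsLocalRing.eq_maximalIdeal h1
    have h3 : (p : ℤ_[p]) ∈ I.comap (algebraMap ℤ_[p] (AdjoinRoot P)) := by
      rw [h2, PadicInt.maximalIdeal_eq_span_p]; exact Ideal.mem_span_singleton_self _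
    rw [Ideal.mem_comap, map_natCast] at h3
    exact (hmax.eq_of_le hI.ne_top ((Ideal.span_singleton_le_iff_mem _).2 h3)).symm
  haveI : IsLocalRing (AdjoinRoot P) := IsLocalRing.of_unique_max_ideal ⟨_, hmax, hu⟩
  refine ⟨inferInstance, ?_, (Ideal.span_singleton_prime hp0).1 hmax.isPrime⟩
  refine ((tfae_of_isNoetherianRing_of_isLocalRing_of_isDomain (AdjoinRoot P)).out 0 4).2 ?_
  rw [← IsLocalRing.eq_maximalIdeal hmax]
  exact ⟨⟨_, rfl⟩⟩

theorem aux_R4 (p : ℕ) [Fact p.Prime] (P : Polynomial ℤ_[p])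
    (S : Subring (AdjoinRoot P)) (ht : AdjoinRoot.root P ∈ S)
    (hp : ∀ a, (p : AdjoinRoot P) * a ∈ S) : S = ⊤ := by
  rw [eq_top_iff]
  rintro x -
  obtain ⟨g, rfl⟩ := AdjoinRoot.mk_surjective x
  have hC : ∀ a : ℤ_[p], AdjoinRoot.of P a ∈ S := by
    intro a
    have h := (PadicInt.zmodRepr_spec a).2
    rw [PadicInt.maximalIdeal_eq_span_p, Ideal.mem_span_singleton] at h
    obtain ⟨b, hb⟩ := h
    rw [sub_eq_iff_eq_add] at hb
    rw [hb, map_add, map_mul, map_natCast, map_natCast]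
    exact S.add_mem (hp _) (natCast_mem S _)
  induction g using Polynomial.induction_on' with
  | add a b ha hb => rw [map_add]; exact S.add_mem ha hb
  | monomial n a =>
    rw [← Polynomial.C_mul_X_pow_eq_monomial, map_mul, map_pow, AdjoinRoot.mk_X, AdjoinRoot.mk_C]
    exact S.mul_mem (hC a) (S.pow_mem ht n)

theorem aux_cok_s11 {A B : Type} [CommRing A] [CommRing B] (P : Polynomial A) (f : A →+* B)
    (hf : Function.Surjective f) (c : A) (hc : RingHom.ker f = Ideal.span {c}) {n : ℕ}
    (M : Matrix (Fin n) (Fin n) A) :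
    Nonempty (((Fin n → AdjoinRoot P) ⧸
      (LinearMap.range ((M.map (AdjoinRoot.of P)).mulVecLin -
        AdjoinRoot.root P • (LinearMap.id : (Fin n → AdjoinRoot P) →ₗ[AdjoinRoot P] _)) ⊔
        LinearMap.range (LinearMap.lsmul (AdjoinRoot P) (Fin n → AdjoinRoot P)
          (AdjoinRoot.of P c)))) ≃+
      ((Fin n → B) ⧸ LinearMap.range (Polynomial.aeval (M.map f) (P.map f)).mulVecLin)) := by
  classical
  set L : Submodule (AdjoinRoot P) (Fin n → AdjoinRoot P) :=
    (LinearMap.range ((M.map (AdjoinRoot.of P)).mulVecLin -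
        AdjoinRoot.root P • (LinearMap.id : (Fin n → AdjoinRoot P) →ₗ[AdjoinRoot P] _)) ⊔
        LinearMap.range (LinearMap.lsmul (AdjoinRoot P) (Fin n → AdjoinRoot P)
          (AdjoinRoot.of P c))) with hL
  set K := LinearMap.range (Polynomial.aeval (M.map f) (P.map f)).mulVecLin with hK
  have hMv : ∀ v : Fin n → A, (M.map (AdjoinRoot.of P)).mulVec (AdjoinRoot.of P ∘ v) =
      AdjoinRoot.of P ∘ (M.mulVec v) := by
    intro v
    ext i
    exact (RingHom.map_mulVec (AdjoinRoot.of P) M v i).symm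
  have hLM : ∀ w : Fin n → AdjoinRoot P,
      (M.map (AdjoinRoot.of P)).mulVec w - AdjoinRoot.root P • w ∈ L := by
    intro w
    exact Submodule.mem_sup_left ⟨w, by simp⟩
  have hLc : ∀ w : Fin n → AdjoinRoot P, AdjoinRoot.of P c • w ∈ L := by
    intro w
    exact Submodule.mem_sup_right ⟨w, by simp⟩
  have key : ∀ (g : Polynomial A) (v : Fin n → A),
      AdjoinRoot.mk P g • (AdjoinRoot.of P ∘ v) -
        AdjoinRoot.of P ∘ ((Polynomial.aeval M g).mulVec v) ∈ L := by
    intro g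
    induction g using Polynomial.induction_on with
    | C a =>
      intro v
      have : AdjoinRoot.mk P (Polynomial.C a) • (AdjoinRoot.of P ∘ v) -
        AdjoinRoot.of P ∘ ((Polynomial.aeval M (Polynomial.C a)).mulVec v) = 0 := by
        ext i
        simp [Algebra.algebraMap_eq_smul_one, Matrix.smul_mulVec]
      rw [this]; exact L.zero_mem
    | add a b ha hb =>
      intro v
      convert L.add_mem (ha v) (hb v) using 1
      ext i
      simp [Matrix.add_mulVec, add_mul]
      ring
    | monomial k a ih =>
      intro v
      have e1 := L.smul_mem (AdjoinRoot.root P) (ih v)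
      have e2 := hLM (AdjoinRoot.of P ∘
        ((Polynomial.aeval M (Polynomial.C a * Polynomial.X ^ k)).mulVec v))
      convert L.sub_mem e1 e2 using 1
      rw [hMv, Matrix.mulVec_mulVec]
      have : Polynomial.aeval M (Polynomial.C a * Polynomial.X ^ (k + 1)) =
          M * Polynomial.aeval M (Polynomial.C a * Polynomial.X ^ k) := by
        simp [pow_succ', Algebra.algebraMap_eq_smul_one]
      rw [this]
      ext i
      simp [pow_succ]
      ring
  let ψ : (Fin n → A) →+ (Fin n → AdjoinRoot P) ⧸ L :=
    (L.mkQ.toAddMonoidHom).comp ((AdjoinRoot.of P).toAddMonoidHom.compLeft (Fin n))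
  let χ : (Fin n → A) →+ (Fin n → B) ⧸ K :=
    (K.mkQ.toAddMonoidHom).comp (f.toAddMonoidHom.compLeft (Fin n))
  have hψ0 : ∀ u, ψ u = 0 ↔ AdjoinRoot.of P ∘ u ∈ L := fun u =>
    Submodule.Quotient.mk_eq_zero L
  have hχ0 : ∀ u, χ u = 0 ↔ f ∘ u ∈ K := fun u =>
    Submodule.Quotient.mk_eq_zero K
  let ev : (Fin n → Polynomial A) → (Fin n → A) := fun w =>
    ∑ j, (Polynomial.aeval M (w j)).mulVec (Pi.single j 1)
  have hψ : Function.Surjective ψ := by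
    intro y
    obtain ⟨w, rfl⟩ := Submodule.Quotient.mk_surjective L y
    choose w' hw' using fun j => AdjoinRoot.mk_surjective (g := P) (w j)
    refine ⟨ev w', ?_⟩
    symm
    refine (Submodule.Quotient.eq L).2 ?_
    have : w - AdjoinRoot.of P ∘ (ev w') = ∑ j, (AdjoinRoot.mk P (w' j) •
      (AdjoinRoot.of P ∘ (Pi.single j 1 : Fin n → A)) -
        AdjoinRoot.of P ∘ ((Polynomial.aeval M (w' j)).mulVec (Pi.single j 1))) := by
      ext i
      simp [ev, hw', Pi.single_apply, Finset.sum_apply]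
    show w - AdjoinRoot.of P ∘ (ev w') ∈ L
    rw [this]
    exact L.sum_mem fun j _ => key _ _
  have hfl : ∀ v : Fin n → B, ∃ u : Fin n → A, f ∘ u = v := by
    intro v
    choose u hu using fun j => hf (v j)
    exact ⟨u, funext hu⟩
  have hχ : Function.Surjective χ := by
    intro y
    obtain ⟨v, rfl⟩ := Submodule.Quotient.mk_surjective K y
    obtain ⟨u, rfl⟩ := hfl v
    exact ⟨u, rfl⟩
  have hPf : ∀ v, (Polynomial.aeval (M.map f) (P.map f)).mulVec (f ∘ v) =
      f ∘ ((Polynomial.aeval M P).mulVec v) := by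
    intro v
    have h1 : Polynomial.aeval (M.map f) (P.map f) = (Polynomial.aeval M P).map f := by
      have := Polynomial.map_aeval_eq_aeval_map (S := Matrix (Fin n) (Fin n) A)
        (U := Matrix (Fin n) (Fin n) B) (φ := f) (ψ := f.mapMatrix) (by
          ext a i j
          simp [Matrix.algebraMap_matrix_apply, apply_ite f]) P M
      exact this.symm
    rw [h1]
    ext i
    exact (RingHom.map_mulVec f _ v i).symm
  have hker : ψ.ker = χ.ker := by
    ext u
    rw [AddMonoidHom.mem_ker, AddMonoidHom.mem_ker, hψ0, hχ0]
    constructor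
    · intro hu
      obtain ⟨y, ⟨w, rfl⟩, z, ⟨w', rfl⟩, hyz⟩ := Submodule.mem_sup.1 hu
      choose a ha using fun j => AdjoinRoot.mk_surjective (g := P) (w j)
      choose b hb using fun j => AdjoinRoot.mk_surjective (g := P) (w' j)
      have h1 : ∀ j, P ∣ Polynomial.C (u j) - (∑ i, Polynomial.C (M j i) * a i -
          Polynomial.X * a j) - Polynomial.C c * b j := by
        intro j
        rw [← AdjoinRoot.mk_eq_zero]
        have := congrFun hyz j
        simp [Matrix.mulVec, dotProduct] at this
        simp [ha, hb, ← this]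
      choose d hd using h1
      have h2 : u = c • ev b + (Polynomial.aeval M P).mulVec (ev d) := by
        have e1 : ev (fun j => ∑ i, Polynomial.C (M j i) * a i) =
            ev (fun j => Polynomial.X * a j) := by
          have c1 : ∀ j, (Polynomial.aeval M (Polynomial.X * a j)).mulVec (Pi.single j 1) =
              ∑ i, M i j • (Polynomial.aeval M (a j)).mulVec (Pi.single i 1) := by
            intro j
            have c2 : M.mulVec (Pi.single j 1) = ∑ i, M i j • (Pi.single i 1 : Fin n → A) := by
              ext k
              simp [Pi.single_apply, Finset.sum_apply]
            rw [mul_comm, map_mul, Polynomial.aeval_X, ← Matrix.mulVec_mulVec, c2,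
              Matrix.mulVec_sum]
            exact Finset.sum_congr rfl fun i _ => Matrix.mulVec_smul _ _ _
          have c3 : ∀ j, (Polynomial.aeval M (∑ i, Polynomial.C (M j i) * a i)).mulVec
              (Pi.single j 1) = ∑ i, M j i • (Polynomial.aeval M (a i)).mulVec (Pi.single j 1) := by
            intro j
            rw [map_sum, Matrix.sum_mulVec]
            refine Finset.sum_congr rfl fun i _ => ?_
            rw [map_mul, Polynomial.aeval_C, Algebra.algebraMap_eq_smul_one, smul_mul_assoc,
              one_mul, Matrix.smul_mulVec]
          simp only [ev, c1, c3]
          exact Finset.sum_comm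
        have e2 : ev (fun j => Polynomial.C (u j)) = u := by
          ext k
          simp [ev, Algebra.algebraMap_eq_smul_one, Matrix.one_apply,
            Finset.sum_apply]
        have e3 : ev (fun j => Polynomial.C c * b j) = c • ev b := by
          simp only [ev, map_mul, Polynomial.aeval_C, Algebra.algebraMap_eq_smul_one,
            smul_mul_assoc, one_mul, Matrix.smul_mulVec, Finset.smul_sum]
        have e4 : ev (fun j => P * d j) = (Polynomial.aeval M P).mulVec (ev d) := by
          simp only [ev, map_mul, ← Matrix.mulVec_mulVec, Matrix.mulVec_sum]
        have e5 : ev (fun j => Polynomial.C (u j) - (∑ i, Polynomial.C (M j i) * a i -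
          Polynomial.X * a j) - Polynomial.C c * b j) = 
          ev (fun j => Polynomial.C (u j)) - (ev (fun j => ∑ i, Polynomial.C (M j i) * a i) - 
            ev (fun j => Polynomial.X * a j)) - ev (fun j => Polynomial.C c * b j) := by
          simp only [ev, map_sub, Matrix.sub_mulVec, Finset.sum_sub_distrib]
        rw [e1, e2, e3, sub_self, sub_zero, funext hd, e4] at e5
        rw [e5]; abel
      refine ⟨f ∘ ev d, ?_⟩
      have hc0 : f c = 0 := by
        rw [← RingHom.mem_ker, hc]; exact Ideal.mem_span_singleton_self _
      rw [Matrix.mulVecLin_apply, hPf]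
      ext i
      have := congrArg f (congrFun h2 i)
      simp [hc0] at this
      simp [this]
    · rintro ⟨v, hv⟩
      obtain ⟨v, rfl⟩ := hfl v
      rw [Matrix.mulVecLin_apply, hPf] at hv
      have h1 : ∀ j, ∃ d, u j - (Polynomial.aeval M P).mulVec v j = d * c := by
        intro j
        have : u j - (Polynomial.aeval M P).mulVec v j ∈ RingHom.ker f := by
          rw [RingHom.mem_ker, map_sub, sub_eq_zero]
          exact (congrFun hv j).symm
        rw [hc] at this
        obtain ⟨d, hd⟩ := Ideal.mem_span_singleton'.1 this
        exact ⟨d, hd.symm⟩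
      choose d hd using h1
      have h3 := L.sub_mem (hLc (AdjoinRoot.of P ∘ d)) (key P v)
      convert h3 using 1
      ext j
      have := congrArg (AdjoinRoot.of P) (hd j)
      simp at this
      simp
      rw [mul_comm, ← this]
      ring
  exact ⟨(QuotientAddGroup.quotientKerEquivOfSurjective ψ hψ).symm.trans
    ((QuotientAddGroup.quotientAddEquivOfEq hker).trans
      (QuotientAddGroup.quotientKerEquivOfSurjective χ hχ))⟩

theorem aux_cok' (p : ℕ) [Fact p.Prime] (P : Polynomial ℤ_[p]) {B : Type} [CommRing B]
    (f : ℤ_[p] →+* B) (hf : Function.Surjective f) (m : ℕ)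
    (hc : RingHom.ker f = Ideal.span {(p : ℤ_[p]) ^ m}) {n : ℕ}
    (M : Matrix (Fin n) (Fin n) ℕ) :
    Nonempty (((Fin n → AdjoinRoot P) ⧸
      (LinearMap.range ((M.map (Nat.cast : ℕ → AdjoinRoot P)).mulVecLin -
        AdjoinRoot.root P • (LinearMap.id : (Fin n → AdjoinRoot P) →ₗ[AdjoinRoot P] _)) ⊔
        LinearMap.range (LinearMap.lsmul (AdjoinRoot P) (Fin n → AdjoinRoot P)
          ((p : AdjoinRoot P) ^ m)))) ≃+
      ((Fin n → B) ⧸ LinearMap.range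
        (Polynomial.aeval (M.map (Nat.cast : ℕ → B)) (P.map f)).mulVecLin)) := by
  have h := aux_cok_s11 P f hf _ hc (M.map (Nat.cast : ℕ → ℤ_[p]))
  have h1 : (M.map (Nat.cast : ℕ → ℤ_[p])).map (AdjoinRoot.of P) =
      M.map (Nat.cast : ℕ → AdjoinRoot P) := by ext i j; simp
  have h2 : (M.map (Nat.cast : ℕ → ℤ_[p])).map f = M.map (Nat.cast : ℕ → B) := by ext i j; simp
  have h3 : AdjoinRoot.of P ((p : ℤ_[p]) ^ m) = (p : AdjoinRoot P) ^ m := by simp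
  rw [h1, h2, h3] at h
  exact h

/-- The lift of `Xb` determined by `Y`, as a matrix of natural numbers. -/
def auxX {p N n : ℕ} (Xb : Matrix (Fin n) (Fin n) (ZMod p))
    (Y : Matrix (Fin n) (Fin n) (ZMod (p ^ N))) : Matrix (Fin n) (Fin n) ℕ :=
  fun i j => (Xb i j).val + p * (Y i j).val

theorem auxX_cast (p N : ℕ) [Fact p.Prime] {n : ℕ} (Xb : Matrix (Fin n) (Fin n) (ZMod p))
    (Y : Matrix (Fin n) (Fin n) (ZMod (p ^ N))) :
    ((auxX Xb Y).map (Nat.cast : ℕ → ZMod (p ^ (N + 1)))).map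
      (ZMod.castHom (dvd_pow_self p (Nat.succ_ne_zero N)) (ZMod p)) = Xb := by
  ext i j
  simp only [Matrix.map_apply, auxX, map_natCast]
  simp

theorem auxX_bij (p N : ℕ) [Fact p.Prime] {n : ℕ} (Xb : Matrix (Fin n) (Fin n) (ZMod p)) :
    Function.Bijective (fun Y : Matrix (Fin n) (Fin n) (ZMod (p ^ N)) =>
      (⟨(auxX Xb Y).map (Nat.cast : ℕ → ZMod (p ^ (N + 1))), auxX_cast p N Xb Y⟩ :
        {X : Matrix (Fin n) (Fin n) (ZMod (p ^ (N + 1))) //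
          X.map (ZMod.castHom (dvd_pow_self p (Nat.succ_ne_zero N)) (ZMod p)) = Xb})) := by
  have hp : 0 < p := (Fact.out : p.Prime).pos
  haveI : NeZero (p ^ N) := ⟨by positivity⟩
  haveI : NeZero (p ^ (N + 1)) := ⟨by positivity⟩
  constructor
  · intro Y Y' h
    ext i j
    have h1 := congrFun (congrFun (congrArg Subtype.val h) i) j
    simp only [Matrix.map_apply, auxX] at h1
    have hb : ∀ Y : Matrix (Fin n) (Fin n) (ZMod (p ^ N)),
        (Xb i j).val + p * (Y i j).val < p ^ (N + 1) := by
      intro Y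
      have a := ZMod.val_lt (Xb i j)
      have b := ZMod.val_lt (Y i j)
      have : p * ((Y i j).val + 1) ≤ p * p ^ N := Nat.mul_le_mul_left _ b
      rw [pow_succ']
      linarith
    have h2 := congrArg ZMod.val h1
    rw [ZMod.val_cast_of_lt (hb Y), ZMod.val_cast_of_lt (hb Y')] at h2
    have h3 : p * (Y i j).val = p * (Y' i j).val := by omega
    exact ZMod.val_injective _ (Nat.eq_of_mul_eq_mul_left hp h3)
  · rintro ⟨X, hX⟩
    refine ⟨fun i j => (((X i j).val / p : ℕ) : ZMod (p ^ N)), ?_⟩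
    apply Subtype.ext
    ext i j
    simp only [Matrix.map_apply, auxX]
    have h1 : (X i j).val / p < p ^ N := by
      rw [Nat.div_lt_iff_lt_mul hp, ← pow_succ]
      exact ZMod.val_lt _
    have h2 : (Xb i j).val = (X i j).val % p := by
      rw [← hX]
      simp only [Matrix.map_apply]
      rw [← ZMod.val_natCast]
      congr 1
      conv_lhs => rw [← ZMod.natCast_zmod_val (X i j), map_natCast]
    rw [ZMod.val_cast_of_lt h1, h2, Nat.mod_add_div, ZMod.natCast_zmod_val]

theorem aux_arith (q r : ℕ) (hq1 : 1 < q) :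
    (((∏ i : Fin r, (q ^ r - q ^ (i : ℕ)) : ℕ)) : ℚ) =
      (q : ℚ) ^ (r ^ 2) * ∏ i ∈ Finset.Icc 1 r, (1 - (q : ℚ)⁻¹ ^ i) := by
  have hq0 : (q : ℚ) ≠ 0 := by positivity
  rw [Fin.prod_univ_eq_prod_range (fun i => q ^ r - q ^ i) r, Nat.cast_prod,
    ← Finset.prod_range_reflect]
  have h1 : ∀ i ∈ Finset.range r, ((q ^ r - q ^ (r - 1 - i) : ℕ) : ℚ) =
      (q : ℚ) ^ r * (1 - (q : ℚ)⁻¹ ^ (i + 1)) := by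
    intro i hi
    rw [Finset.mem_range] at hi
    rw [Nat.cast_sub (Nat.pow_le_pow_right (by omega) (by omega))]
    push_cast
    have : (q : ℚ) ^ r = q ^ (r - 1 - i) * q ^ (i + 1) := by
      rw [← pow_add]; congr 1; omega
    rw [mul_sub, mul_one, inv_pow]
    congr 1
    rw [this]
    field_simp
  rw [Finset.prod_congr rfl h1, Finset.prod_mul_distrib, Finset.prod_const, Finset.card_range,
    ← pow_mul, sq]
  congr 1
  rw [Finset.range_eq_Ico, Finset.prod_Ico_add' (fun i => 1 - (q : ℚ)⁻¹ ^ i) 0 r 1]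
  rfl

open Pointwise

/-- Theorem 1.3 (`l = 1` case): for monic `P ∈ ℤ_p[t]` of degree ≤ 2 with irreducible
reduction mod `p`, a finite `ℤ_p[t]/(P)`-module `G`, and a fixed `X̄ ∈ Mat_n(𝔽_p)`
with `dim_{𝔽_q} cok(P(X̄)) = r`, the number of lifts `X ∈ Mat_n(ℤ/p^{N+1})` of `X̄`
with `cok(P(X)) ≃ G` equals `p^{Nn²} q^{r²} ∏_{i=1}^r (1-q^{-i})² / |Aut(G)|`.
(Per the paper's remark, finite `ℤ_p[t]/(P)`-modules are isomorphic iff they are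
isomorphic as abelian groups, so the cokernel condition is stated via `≃+`.) -/
theorem stmt_11 (p : ℕ) [Fact p.Prime] (P : Polynomial ℤ_[p]) (hP : P.Monic)
    (hdeg : P.natDegree ≤ 2)
    (hirr : Irreducible (P.map (PadicInt.toZMod : ℤ_[p] →+* ZMod p)))
    (q : ℕ) (hq : q = p ^ P.natDegree)
    (G : Type) [AddCommGroup G] [Module (AdjoinRoot P) G] [Finite G]
    (r : ℕ)
    (hr : Nat.card (G ⧸ ((p : AdjoinRoot P) • (⊤ : Submodule (AdjoinRoot P) G))) = q ^ r)
    (N : ℕ) (hN : ∀ x : G, (p : AdjoinRoot P) ^ N • x = 0)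
    (n : ℕ) (Xb : Matrix (Fin n) (Fin n) (ZMod p))
    (hXb : Nat.card ((Fin n → ZMod p) ⧸ LinearMap.range
        (Polynomial.aeval Xb (P.map (PadicInt.toZMod : ℤ_[p] →+* ZMod p))).mulVecLin)
      = q ^ r) :
    (Nat.card {X : Matrix (Fin n) (Fin n) (ZMod (p ^ (N + 1))) //
        X.map (ZMod.castHom (dvd_pow_self p (Nat.succ_ne_zero N)) (ZMod p)) = Xb ∧
        Nonempty (((Fin n → ZMod (p ^ (N + 1))) ⧸ LinearMap.range
          (Polynomial.aeval X (P.map (PadicInt.toZModPow (N + 1)))).mulVecLin) ≃+ G)} : ℚ)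
      = (p : ℚ) ^ (N * n ^ 2) *
          ((q : ℚ) ^ (r ^ 2) * ∏ i ∈ Finset.Icc 1 r, (1 - (q : ℚ)⁻¹ ^ i) ^ 2) /
          (Nat.card (G ≃ₗ[AdjoinRoot P] G) : ℚ) := by

  obtain ⟨hdom, hnoe, hp0⟩ := aux_R1 p P hP hirr
  obtain ⟨hmax, hcard⟩ := aux_R2 p P hP hirr
  obtain ⟨hloc, hpid, hprime⟩ := aux_R3 p P hP hirr
  rw [← hq] at hcard
  have hpp : 1 < p := (Fact.out : p.Prime).one_lt
  have hd : P.natDegree ≠ 0 := by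
    have := hirr.natDegree_pos
    rw [hP.natDegree_map] at this
    omega
  have hq1 : 1 < q := by rw [hq]; exact Nat.one_lt_pow hd hpp
  have hr' : Nat.card (G ⧸ LinearMap.range (LinearMap.lsmul (AdjoinRoot P) G
      (p : AdjoinRoot P))) = q ^ r := by
    rw [← hr]
    have : LinearMap.range (LinearMap.lsmul (AdjoinRoot P) G (p : AdjoinRoot P)) =
        (p : AdjoinRoot P) • (⊤ : Submodule (AdjoinRoot P) G) := by
      ext x
      simp [Submodule.mem_smul_pointwise_iff_exists]
    rw [this]
  have hA : Nat.card ((Fin n → AdjoinRoot P) ⧸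
      (LinearMap.range (((Xb.map ZMod.val).map (Nat.cast : ℕ → AdjoinRoot P)).mulVecLin -
        AdjoinRoot.root P • (LinearMap.id : (Fin n → AdjoinRoot P) →ₗ[AdjoinRoot P] _)) ⊔
        LinearMap.range (LinearMap.lsmul (AdjoinRoot P) (Fin n → AdjoinRoot P)
          (p : AdjoinRoot P)))) = q ^ r := by
    obtain ⟨e⟩ := aux_cok' p P (PadicInt.toZMod : ℤ_[p] →+* ZMod p)
      (ZMod.ringHom_surjective _) 1
      (by rw [PadicInt.ker_toZMod, PadicInt.maximalIdeal_eq_span_p, pow_one]) (Xb.map ZMod.val)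
    have h1 : (Xb.map ZMod.val).map (Nat.cast : ℕ → ZMod p) = Xb := by ext i j; simp
    rw [pow_one, h1] at e
    rw [Nat.card_congr e.toEquiv, hXb]
  have htot := aux_total p hp0 (AdjoinRoot.root P) (aux_R4 p P) N hN (Xb.map ZMod.val) hq1 hcard hr'
    _ rfl hA
  have hcnt : Nat.card {X : Matrix (Fin n) (Fin n) (ZMod (p ^ (N + 1))) //
        X.map (ZMod.castHom (dvd_pow_self p (Nat.succ_ne_zero N)) (ZMod p)) = Xb ∧
        Nonempty (((Fin n → ZMod (p ^ (N + 1))) ⧸ LinearMap.range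
          (Polynomial.aeval X (P.map (PadicInt.toZModPow (N + 1)))).mulVecLin) ≃+ G)} =
      Nat.card {Y : Matrix (Fin n) (Fin n) (ZMod (p ^ N)) //
      Nonempty (((Fin n → AdjoinRoot P) ⧸ (LinearMap.range
        (((Xb.map ZMod.val).map (Nat.cast : ℕ → AdjoinRoot P)).mulVecLin -
        AdjoinRoot.root P • (LinearMap.id : (Fin n → AdjoinRoot P) →ₗ[AdjoinRoot P] _) +
          (p : AdjoinRoot P) • auxLift (AdjoinRoot P) Y) ⊔
        LinearMap.range (LinearMap.lsmul (AdjoinRoot P) (Fin n → AdjoinRoot P)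
          ((p : AdjoinRoot P) ^ (N + 1))))) ≃ₗ[AdjoinRoot P] G)} := by
    refine Nat.card_congr (Equiv.symm (Equiv.trans ?_
      (Equiv.subtypeSubtypeEquivSubtypeInter _ _)))
    refine (Equiv.ofBijective _ (auxX_bij p N Xb)).subtypeEquiv fun Y => ?_
    obtain ⟨e⟩ := aux_cok' p P (PadicInt.toZModPow (N + 1)) (ZMod.ringHom_surjective _) (N + 1)
      (PadicInt.ker_toZModPow _) (auxX Xb Y)
    have hM : ((Xb.map ZMod.val).map (Nat.cast : ℕ → AdjoinRoot P)).mulVecLin -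
        AdjoinRoot.root P • (LinearMap.id : (Fin n → AdjoinRoot P) →ₗ[AdjoinRoot P] _) +
          (p : AdjoinRoot P) • auxLift (AdjoinRoot P) Y =
        ((auxX Xb Y).map (Nat.cast : ℕ → AdjoinRoot P)).mulVecLin -
        AdjoinRoot.root P • (LinearMap.id : (Fin n → AdjoinRoot P) →ₗ[AdjoinRoot P] _) := by
      have h2 : (auxX Xb Y).map (Nat.cast : ℕ → AdjoinRoot P) =
          (Xb.map ZMod.val).map (Nat.cast : ℕ → AdjoinRoot P) +
          (p : AdjoinRoot P) • Y.map (fun y => ((y.val : ℕ) : AdjoinRoot P)) := by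
        ext i j
        simp [auxX]
      have h3 : ∀ (a : AdjoinRoot P) (W : Matrix (Fin n) (Fin n) (AdjoinRoot P)),
          (a • W).mulVecLin = a • W.mulVecLin :=
        fun a W => LinearMap.ext fun v => Matrix.smul_mulVec a W v
      rw [h2, Matrix.mulVecLin_add, h3, auxLift]
      abel
    rw [hM]
    constructor
    · rintro ⟨g⟩
      exact ⟨e.symm.trans g.toAddEquiv⟩
    · rintro ⟨g⟩
      exact aux_classify hprime hq1 hcard _ _ N hN (e.trans g)
  rw [hcnt]
  have hfin : Finite (G ≃ₗ[AdjoinRoot P] G) :=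
    Finite.of_injective (fun e => (e : G → G)) DFunLike.coe_injective
  have hAut : (Nat.card (G ≃ₗ[AdjoinRoot P] G) : ℚ) ≠ 0 := by
    haveI : Nonempty (G ≃ₗ[AdjoinRoot P] G) := ⟨LinearEquiv.refl _ _⟩
    exact_mod_cast Nat.card_pos.ne'
  have hq0 : (q : ℚ) ≠ 0 := by positivity
  rw [eq_div_iff hAut]
  have ht := congrArg (Nat.cast : ℕ → ℚ) htot
  rw [Nat.cast_mul, Nat.cast_mul, Nat.cast_mul, Nat.cast_pow (∏ i : Fin r, _), aux_arith q r hq1]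
    at ht
  push_cast at ht
  rw [← pow_mul, ← sq] at ht
  have hqr : (q : ℚ) ^ (r ^ 2) ≠ 0 := pow_ne_zero _ hq0
  apply mul_right_cancel₀ hqr
  rw [ht, Finset.prod_pow]
  ring
end
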